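/- There is an absolute constant C > 0 (independent of all problem parameters) such that, under assumptions (A1)–(A4), for every horizon T ≥ 1 the AdaGrad iterates satisfy E[(1/T)∑_{t=1}^T ‖∇f(x_t)‖₁] ≤ C·[ (dλ + Δ/γ + γ‖L‖₁ ln K_T)/√T + ‖σ‖₁ (ln K_T)^{1/p̄ + 1/2} / T^{(p−1)/p} + √((Δ/γ + γ‖L‖₁ ln K_T)·‖σ‖₁) / T^{(p−1)/(2p)} + ‖σ‖₁ (ln K_T)^{1/(2p̄) + 1/4} / T^{(3p−4)/(4p)} ], where Δ = f(x₁) − f_* and K_T = 1 + (√2·‖σ‖_∞·T^{1/p} + 2‖∇f(x₁)‖_∞·T^{1/2} + 2γ√(‖L‖₁‖L‖_∞)·T^{3/2})/λ. -/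

import Mathlib

open MeasureTheory Finset

/-- The AdaGrad accumulator `v_{t,i} = ∑_{s=1}^t g_{s,i}²`. -/
noncomputable def adaV {Ω : Type} {d : ℕ} (g : ℕ → Ω → EuclideanSpace ℝ (Fin d))
    (t : ℕ) (ω : Ω) (i : Fin d) : ℝ :=
  ∑ s ∈ Finset.Icc 1 t, (g s ω i) ^ 2

/-- The natural filtration `F_t = σ(g_1, …, g_t)`. -/
noncomputable def natFilt {Ω : Type} [MeasurableSpace Ω] {d : ℕ}
    (g : ℕ → Ω → EuclideanSpace ℝ (Fin d)) (t : ℕ) : MeasurableSpace Ω :=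
  ⨆ s ∈ Finset.Icc 1 t, MeasurableSpace.comap (g s) inferInstance

/-- The logarithmic potential bound for AdaGrad step sizes. -/
lemma sum_sq_div_sq_le_log (G : ℕ → ℝ) {lam : ℝ} (hl : 0 < lam) (T : ℕ) :
    ∑ t ∈ Icc 1 T, (|G t| / (lam + √(∑ s ∈ Icc 1 t, G s ^ 2))) ^ 2 ≤
      2 * Real.log (1 + √(∑ s ∈ Icc 1 T, G s ^ 2) / lam) := by
  induction T with
  | zero => simp
  | succ T ih =>
    rw [sum_Icc_succ_top (by omega)]
    have hv : 0 ≤ ∑ s ∈ Icc 1 T, G s ^ 2 := sum_nonneg fun _ _ => sq_nonneg _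
    have hv' : ∑ s ∈ Icc 1 (T + 1), G s ^ 2 = ∑ s ∈ Icc 1 T, G s ^ 2 + G (T + 1) ^ 2 :=
      sum_Icc_succ_top (by omega) _
    rw [hv']
    set v := ∑ s ∈ Icc 1 T, G s ^ 2
    set y := G (T + 1)
    set A := √v
    set B := √(v + y ^ 2)
    have hA : 0 ≤ A := Real.sqrt_nonneg _
    have hB : A ≤ B := Real.sqrt_le_sqrt (by nlinarith [sq_nonneg y])
    have hA2 : A ^ 2 = v := Real.sq_sqrt hv
    have hB2 : B ^ 2 = v + y ^ 2 := Real.sq_sqrt (by positivity)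
    have hratio : Real.log (1 + A / lam) ≤ Real.log (1 + B / lam) - (B - A) / (lam + B) := by
      have h1 : 1 + A / lam = (1 + B / lam) * ((lam + A) / (lam + B)) := by
        have : lam + B ≠ 0 := by positivity
        field_simp
      rw [h1, Real.log_mul (by positivity) (by positivity)]
      have h2 := Real.log_le_sub_one_of_pos (show 0 < (lam + A) / (lam + B) by positivity)
      have h3 : (lam + A) / (lam + B) - 1 = - ((B - A) / (lam + B)) := by
        have : lam + B ≠ 0 := by positivity
        field_simp
        ring
      linarith
    have hterm : (|y| / (lam + B)) ^ 2 ≤ 2 * ((B - A) / (lam + B)) := by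
      rw [div_pow, sq_abs, mul_div_assoc', div_le_div_iff₀ (by positivity) (by positivity)]
      have h4 : y ^ 2 = (B - A) * (B + A) := by nlinarith
      rw [h4]
      have h5 : 0 ≤ (B - A) * (lam + B) := mul_nonneg (by linarith) (by positivity)
      nlinarith
    linarith

/-- Replacing the AdaGrad step size by the predictable one costs at most a noise term and
an offset term. -/
lemma abs_step_sub_proxy_le {lam v h y s : ℝ} (hl : 0 < lam) (hv : 0 ≤ v) (hs : 0 ≤ s) :
    h * y / (lam + √(v + h ^ 2 + s ^ 2)) - h * y / (lam + √(v + y ^ 2)) ≤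
      (|y - h| + s) * (|h| / (lam + √(v + h ^ 2 + s ^ 2))) * (|y| / (lam + √(v + y ^ 2))) := by
  set A := √(v + h ^ 2 + s ^ 2)
  set B := √(v + y ^ 2)
  have hA : 0 ≤ A := Real.sqrt_nonneg _
  have hB : 0 ≤ B := Real.sqrt_nonneg _
  have hA2 : A ^ 2 = v + h ^ 2 + s ^ 2 := Real.sq_sqrt (by positivity)
  have hB2 : B ^ 2 = v + y ^ 2 := Real.sq_sqrt (by positivity)
  have hAh : |h| ≤ A := Real.abs_le_sqrt (by nlinarith [sq_nonneg s])
  have hAs : s ≤ A := Real.le_sqrt_of_sq_le (by nlinarith [sq_nonneg h])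
  have hBy : |y| ≤ B := Real.abs_le_sqrt (by nlinarith)
  have key : |B - A| ≤ |y - h| + s := by
    rcases eq_or_lt_of_le (add_nonneg hA hB) with h0 | h0
    · have : A = 0 := by linarith
      have : B = 0 := by linarith
      rw [‹A = 0›, ‹B = 0›, sub_zero, abs_zero]
      positivity
    · have e : |B - A| * (A + B) = |(y - h) * (y + h) - s ^ 2| := by
        nth_rewrite 1 [← abs_of_pos h0]
        rw [← abs_mul]
        congr 1
        nlinarith
      refine le_of_mul_le_mul_right ?_ h0
      rw [e]
      calc |(y - h) * (y + h) - s ^ 2| ≤ |(y - h) * (y + h)| + |s ^ 2| := abs_sub _ _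
        _ = |y - h| * |y + h| + s * s := by rw [abs_mul, abs_of_nonneg (sq_nonneg s), sq]
        _ ≤ |y - h| * (A + B) + s * (A + B) := by
          gcongr
          · exact (abs_add_le _ _).trans (by linarith)
          · linarith
        _ = _ := by ring
  have e : h * y / (lam + A) - h * y / (lam + B) = (h * y) * (B - A) / ((lam + A) * (lam + B)) := by
    have : lam + A ≠ 0 := by positivity
    have : lam + B ≠ 0 := by positivity
    field_simp
    ring
  rw [e]
  calc (h * y) * (B - A) / ((lam + A) * (lam + B))
      ≤ |(h * y) * (B - A)| / ((lam + A) * (lam + B)) := by gcongr; exact le_abs_self _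
    _ = |B - A| * (|h| / (lam + A)) * (|y| / (lam + B)) := by
      rw [abs_mul, abs_mul]
      field_simp
    _ ≤ _ := by gcongr

/-- A three-factor Young inequality, with the factor `u ∈ [0, 1]` raised to the power two. -/
lemma mul_mul_le_young {a z u s p : ℝ} (ha : 0 ≤ a) (hz : 0 ≤ z) (hu : 0 ≤ u) (hu1 : u ≤ 1)
    (hs : 0 < s) (hp : 1 < p) (hp2 : p ≤ 2) :
    a * z * u ≤ s * s⁻¹ ^ p / p * (a ^ p * z ^ p) + s * u ^ 2 := by
  have hc : p.HolderConjugate p.conjExponent := Real.HolderConjugate.conjExponent hp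
  have hy := Real.young_inequality_of_nonneg (a := s⁻¹ * (a * z)) (b := u) (by positivity) hu hc
  have hq2 : 2 ≤ p.conjExponent := by
    rw [Real.conjExponent, le_div_iff₀ (by linarith)]
    linarith
  have hu2 : u ^ p.conjExponent / p.conjExponent ≤ u ^ 2 := by
    have h1 : u ^ p.conjExponent ≤ u ^ (2 : ℝ) :=
      Real.rpow_le_rpow_of_exponent_ge' hu hu1 (by norm_num) hq2
    rw [Real.rpow_two] at h1
    exact (div_le_self (by positivity) (by linarith)).trans h1
  rw [Real.mul_rpow (by positivity) (by positivity), Real.mul_rpow ha hz] at hy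
  have : a * z * u = s * (s⁻¹ * (a * z) * u) := by field_simp
  rw [this]
  calc s * (s⁻¹ * (a * z) * u) ≤ s * (s⁻¹ ^ p * (a ^ p * z ^ p) / p + u ^ 2) := by
        gcongr; linarith
    _ = _ := by ring

/-- Interpolation of `a ^ p` between `a ^ 2` and a constant. -/
lemma rpow_scale_le {a s q p : ℝ} (ha : 0 ≤ a) (hs : 0 < s) (hq : 0 < q) (hp : 1 < p)
    (hp2 : p ≤ 2) :
    s * s⁻¹ ^ p / p * ((s * q ^ (2 / p - 1)) ^ p * a ^ p) ≤ s * a ^ 2 / 2 + s * q ^ 2 := by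
  have h1 : (s * q ^ (2 / p - 1)) ^ p = s ^ p * q ^ (2 - p) := by
    rw [Real.mul_rpow hs.le (by positivity), ← Real.rpow_mul hq.le]
    congr 2
    field_simp
  have h2 : s⁻¹ ^ p * s ^ p = 1 := by
    rw [← Real.mul_rpow (by positivity) hs.le, inv_mul_cancel₀ hs.ne', Real.one_rpow]
  have h3 := Real.geom_mean_le_arith_mean2_weighted (w₁ := p / 2) (w₂ := 1 - p / 2)
    (p₁ := a ^ 2) (p₂ := q ^ 2) (by linarith) (by linarith) (by positivity) (by positivity)
    (by ring)
  rw [← Real.rpow_two, ← Real.rpow_two, ← Real.rpow_mul ha, ← Real.rpow_mul hq.le,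
    show 2 * (p / 2) = p by ring, show 2 * (1 - p / 2) = 2 - p by ring, Real.rpow_two,
    Real.rpow_two] at h3
  calc s * s⁻¹ ^ p / p * ((s * q ^ (2 / p - 1)) ^ p * a ^ p)
      = s / p * (s⁻¹ ^ p * s ^ p) * (a ^ p * q ^ (2 - p)) := by rw [h1]; ring
    _ ≤ s / p * 1 * (p / 2 * a ^ 2 + (1 - p / 2) * q ^ 2) := by rw [h2]; gcongr
    _ = s * a ^ 2 / 2 + s * ((1 / p - 1 / 2) * q ^ 2) := by field_simp
    _ ≤ s * a ^ 2 / 2 + s * (1 * q ^ 2) := by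
      gcongr
      have : 1 / p ≤ 1 := by rw [div_le_one (by linarith)]; exact hp.le
      linarith
    _ = _ := by ring

/-- The `ℓ²` norm is at most the `ℓ^p` norm for `p ≤ 2`. -/
lemma sqrt_sum_sq_le_rpow_sum {ι : Type*} (S : Finset ι) (z : ι → ℝ) {p : ℝ} (hp : 1 < p)
    (hp2 : p ≤ 2) : √(∑ t ∈ S, z t ^ 2) ≤ (∑ t ∈ S, |z t| ^ p) ^ (1 / p) := by
  set Y := ∑ t ∈ S, |z t| ^ p with hY
  have hY0 : 0 ≤ Y := sum_nonneg fun _ _ => by positivity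
  have hp0 : (0 : ℝ) < p := by linarith
  refine Real.sqrt_le_iff.2 ⟨by positivity, ?_⟩
  have hz : ∀ t ∈ S, |z t| ≤ Y ^ (1 / p) := fun t ht => by
    have h1 : |z t| ^ p ≤ Y :=
      single_le_sum (f := fun t => |z t| ^ p) (fun _ _ => by positivity) ht
    calc |z t| = (|z t| ^ p) ^ (1 / p) := by
          rw [← Real.rpow_mul (abs_nonneg _), mul_one_div_cancel hp0.ne', Real.rpow_one]
      _ ≤ _ := by gcongr
  calc ∑ t ∈ S, z t ^ 2 = ∑ t ∈ S, |z t| ^ p * |z t| ^ (2 - p) := by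
        refine sum_congr rfl fun t _ => ?_
        rw [← Real.rpow_add_of_nonneg (abs_nonneg _) hp0.le (by linarith), add_sub_cancel,
          Real.rpow_two, sq_abs]
    _ ≤ ∑ t ∈ S, |z t| ^ p * (Y ^ (1 / p)) ^ (2 - p) := by
        refine sum_le_sum fun t ht => ?_
        exact mul_le_mul_of_nonneg_left
          (Real.rpow_le_rpow (abs_nonneg _) (hz t ht) (by linarith)) (by positivity)
    _ = (Y ^ (1 / p)) ^ p * (Y ^ (1 / p)) ^ (2 - p) := by
        rw [← sum_mul, ← hY, ← Real.rpow_mul hY0 (1 / p) p, one_div_mul_cancel hp0.ne',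
          Real.rpow_one]
    _ = (Y ^ (1 / p)) ^ 2 := by
        rw [← Real.rpow_add_of_nonneg (by positivity) hp0.le (by linarith), add_sub_cancel,
          Real.rpow_two]

lemma sqrt_sum_add_sq_le {ι : Type*} (S : Finset ι) (a b : ι → ℝ) :
    √(∑ t ∈ S, (a t + b t) ^ 2) ≤ √(∑ t ∈ S, a t ^ 2) + √(∑ t ∈ S, b t ^ 2) := by
  have h := Real.Lp_add_le S a b (p := 2) (by norm_num)
  simpa [Real.sqrt_eq_rpow] using h

/-- Optimising a family of AM-GM bounds. -/
lemma le_two_mul_sqrt_of_forall {y a b : ℝ} (ha : 0 ≤ a) (hb : 0 ≤ b)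
    (h : ∀ θ : ℝ, 0 < θ → y ≤ θ * a + b / θ) : y ≤ 2 * √(a * b) := by
  refine le_of_forall_pos_le_add fun ε hε => ?_
  rcases eq_or_lt_of_le ha with h0 | h0
  · subst h0
    have := h ((b + 1) / ε) (by positivity)
    have h2 : b / ((b + 1) / ε) ≤ ε := by
      rw [div_div_eq_mul_div, div_le_iff₀ (by positivity)]
      nlinarith
    simp
    linarith
  rcases eq_or_lt_of_le hb with h1 | h1
  · subst h1
    have := h (ε / a) (by positivity)
    have h2 : ε / a * a = ε := by field_simp
    simp
    simp at this
    linarith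
  · have h2 := h (√b / √a) (by positivity)
    have ea : a = √a * √a := (Real.mul_self_sqrt ha).symm
    have eb : b = √b * √b := (Real.mul_self_sqrt hb).symm
    have hpa : 0 < √a := by positivity
    have hpb : 0 < √b := by positivity
    have e1 : √b / √a * a = √a * √b := by
      nth_rewrite 2 [ea]
      field_simp
    have e2 : b / (√b / √a) = √a * √b := by
      nth_rewrite 1 [eb]
      field_simp
    rw [Real.sqrt_mul ha]
    linarith

/-- Solving the self-bounding inequality for the gradient energy. -/
lemma le_of_sq_le_mul_add {S A W θ : ℝ} (hA : 0 ≤ A) (hW : 0 ≤ W) (hθ : 0 < θ)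
    (h : S ^ 2 ≤ A * (W + 2 * S)) : S ≤ 2 * A + (θ * A + W / θ) := by
  by_contra! hlt
  have h1 : 0 ≤ W / θ := by positivity
  have h2 : 0 ≤ θ * A := by positivity
  have h3 : θ * A * (W / θ) = A * W := by field_simp
  nlinarith

/-- A coordinate-wise quadratic approximation bound makes the gradient Lipschitz. -/
lemma abs_grad_sub_le {d : ℕ} {f : EuclideanSpace ℝ (Fin d) → ℝ}
    {gradf : EuclideanSpace ℝ (Fin d) → EuclideanSpace ℝ (Fin d)} {L : Fin d → ℝ}
    (hL : ∀ i, 0 < L i)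
    (hsm : ∀ u v : EuclideanSpace ℝ (Fin d),
      |f u - f v - ∑ i, gradf v i * (u i - v i)| ≤ 1 / 2 * ∑ i, L i * (u i - v i) ^ 2)
    (x y : EuclideanSpace ℝ (Fin d)) (i : Fin d) :
    |gradf y i - gradf x i| ≤ 3 * (√(L i) * √(∑ j, L j * (y j - x j) ^ 2)) := by
  set Q := ∑ j, L j * (y j - x j) ^ 2 with hQ
  have hQ0 : 0 ≤ Q := sum_nonneg fun j _ => mul_nonneg (hL j).le (sq_nonneg _)
  have key : ∀ c : ℝ, c * (gradf y i - gradf x i) ≤ 3 / 2 * (L i * c ^ 2 + Q) := by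
    intro c
    set z : EuclideanSpace ℝ (Fin d) := EuclideanSpace.single i c with hz
    have hzi : ∀ w : Fin d → ℝ, ∑ j, w j * z j = w i * c := fun w => by
      simp [hz, PiLp.single_apply]
    have hz2 : ∑ j, L j * z j ^ 2 = L i * c ^ 2 := by
      have := hzi fun j => L j * z j
      simp only [sq, ← mul_assoc]
      rw [this]
      simp [hz]
    have h1 := hsm (y + z) y
    have h2 := hsm (y + z) x
    have h3 := hsm y x
    have e1 : ∑ j, gradf y j * ((y + z) j - y j) = gradf y i * c := by
      simpa using hzi fun j => gradf y j
    have e1' : ∑ j, L j * ((y + z) j - y j) ^ 2 = L i * c ^ 2 := by simpa using hz2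
    have e2 : ∑ j, gradf x j * ((y + z) j - x j) =
        ∑ j, gradf x j * (y j - x j) + gradf x i * c := by
      rw [← hzi fun j => gradf x j, ← sum_add_distrib]
      exact sum_congr rfl fun j _ => by simp; ring
    have e2' : ∑ j, L j * ((y + z) j - x j) ^ 2 ≤ 2 * Q + 2 * (L i * c ^ 2) := by
      rw [← hz2, hQ, mul_sum, mul_sum, ← sum_add_distrib]
      refine sum_le_sum fun j _ => ?_
      have : (y + z) j = y j + z j := rfl
      rw [this]
      nlinarith [mul_nonneg (hL j).le (sq_nonneg ((y j - x j) - z j))]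
    rw [e1, e1', abs_le] at h1
    rw [e2, abs_le] at h2
    rw [abs_le] at h3
    nlinarith
  have hLi := hL i
  have hcase : ∀ D : ℝ, (∀ c : ℝ, c * D ≤ 3 / 2 * (L i * c ^ 2 + Q)) →
      D ≤ 3 * (√(L i) * √Q) := by
    intro D hD
    have h4 := le_two_mul_sqrt_of_forall (y := D) (a := 3 / 2 * L i) (b := 3 / 2 * Q)
      (by positivity) (by positivity) fun θ hθ => by
        have := hD θ
        have h5 : D = θ * D / θ := by field_simp
        rw [h5, div_le_iff₀ hθ]
        calc θ * D ≤ _ := this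
          _ = _ := by field_simp
    have h6 : √(3 / 2 * L i * (3 / 2 * Q)) = 3 / 2 * (√(L i) * √Q) := by
      rw [← Real.sqrt_mul hLi.le, show 3 / 2 * L i * (3 / 2 * Q) = (3 / 2) ^ 2 * (L i * Q) by ring,
        Real.sqrt_mul (by positivity), Real.sqrt_sq (by norm_num)]
    rw [h6] at h4
    linarith
  rw [abs_le']
  refine ⟨hcase _ key, hcase _ fun c => ?_⟩
  have := key (-c)
  nlinarith

/-- A bounded factor that is measurable for the conditioning σ-algebra can be tested against
the conditional expectation. -/
lemma integral_mul_condExp_eq {Ω : Type*} {m m0 : MeasurableSpace Ω} {μ : Measure Ω}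
    [IsProbabilityMeasure μ] (hm : m ≤ m0) {φ X : Ω → ℝ} {c : ℝ} (hφ : Measurable[m] φ)
    (hφc : ∀ ω, |φ ω| ≤ c) (hX : Integrable X μ) :
    Integrable (fun ω => φ ω * X ω) μ ∧ ∫ ω, φ ω * X ω ∂μ = ∫ ω, φ ω * (μ[X|m]) ω ∂μ := by
  have hi : Integrable (fun ω => φ ω * X ω) μ :=
    hX.bdd_mul (hφ.mono hm le_rfl).aestronglyMeasurable (c := c)
      (.of_forall fun ω => by simpa using hφc ω)
  refine ⟨hi, ?_⟩
  rw [← integral_condExp hm]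
  exact integral_congr_ae (condExp_mul_of_stronglyMeasurable_left hφ.stronglyMeasurable hi hX)

/-- The correlation between the noise and the AdaGrad step is controlled by the proxy energy. -/
lemma integral_mul_abs_mul_le {Ω : Type*} {m m0 : MeasurableSpace Ω} {μ : Measure Ω}
    [IsProbabilityMeasure μ] (hm : m ≤ m0) {a u ξ : Ω → ℝ} {s q p : ℝ}
    (ha : Measurable[m] a) (ha0 : ∀ ω, 0 ≤ a ω) (ha1 : ∀ ω, a ω ≤ 1)
    (hu : Measurable u) (hu0 : ∀ ω, 0 ≤ u ω) (hu1 : ∀ ω, u ω ≤ 1)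
    (hξ : Integrable ξ μ) (hs : 0 ≤ s) (hq : 0 < q) (hp : 1 < p) (hp2 : p ≤ 2)
    (hξp : Integrable (fun ω => |ξ ω| ^ p) μ)
    (hcond : ∀ᵐ ω ∂μ, (μ[fun ω => |ξ ω| ^ p|m]) ω ≤ (s * q ^ (2 / p - 1)) ^ p) :
    Integrable (fun ω => a ω * |ξ ω| * u ω) μ ∧
    ∫ ω, a ω * |ξ ω| * u ω ∂μ ≤
      s / 2 * ∫ ω, a ω ^ 2 ∂μ + s * q ^ 2 + s * ∫ ω, u ω ^ 2 ∂μ := by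
  have ha' : Measurable a := ha.mono hm le_rfl
  have hp0 : 0 < p := by linarith
  have hInt : Integrable (fun ω => a ω * |ξ ω| * u ω) μ := by
    refine hξ.abs.mono' ((ha'.aestronglyMeasurable.mul hξ.abs.aestronglyMeasurable).mul
      hu.aestronglyMeasurable) (.of_forall fun ω => ?_)
    have h0 := ha0 ω
    have h1 := hu0 ω
    rw [Real.norm_of_nonneg (by positivity)]
    calc a ω * |ξ ω| * u ω ≤ 1 * |ξ ω| * 1 := by gcongr; exacts [ha1 ω, hu1 ω]
      _ = |ξ ω| := by ring
  refine ⟨hInt, ?_⟩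
  have hap : ∀ ω, |a ω ^ p| ≤ 1 := fun ω => by
    rw [abs_of_nonneg (Real.rpow_nonneg (ha0 ω) _)]
    exact Real.rpow_le_one (ha0 ω) (ha1 ω) hp0.le
  have hbdd : ∀ w : Ω → ℝ, Measurable w → (∀ ω, 0 ≤ w ω) → (∀ ω, w ω ≤ 1) → Integrable w μ :=
    fun w hw h0 h1 => (integrable_const (1 : ℝ)).mono' hw.aestronglyMeasurable
      (.of_forall fun ω => by rw [Real.norm_of_nonneg (h0 ω)]; exact h1 ω)
  have ha2 : Integrable (fun ω => a ω ^ 2) μ := hbdd _ (ha'.pow_const 2) (fun ω => sq_nonneg _)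
    fun ω => pow_le_one₀ (ha0 ω) (ha1 ω)
  have hu2 : Integrable (fun ω => u ω ^ 2) μ := hbdd _ (hu.pow_const 2) (fun ω => sq_nonneg _)
    fun ω => pow_le_one₀ (hu0 ω) (hu1 ω)
  have hapi : Integrable (fun ω => a ω ^ p) μ := hbdd _ (ha'.pow_const p)
    (fun ω => Real.rpow_nonneg (ha0 ω) _) fun ω => Real.rpow_le_one (ha0 ω) (ha1 ω) hp0.le
  obtain ⟨hi, he⟩ := integral_mul_condExp_eq (φ := fun ω => a ω ^ p) hm (ha.pow_const p) hap hξp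
  have hle : ∫ ω, a ω ^ p * |ξ ω| ^ p ∂μ ≤ ∫ ω, (s * q ^ (2 / p - 1)) ^ p * a ω ^ p ∂μ := by
    rw [he]
    refine integral_mono_ae ?_ (hapi.const_mul _) ?_
    · exact integrable_condExp.bdd_mul (ha'.pow_const p).aestronglyMeasurable (c := 1)
        (.of_forall fun ω => by simpa using hap ω)
    · filter_upwards [hcond] with ω hω
      have := Real.rpow_nonneg (ha0 ω) p
      nlinarith
  rcases eq_or_lt_of_le hs with h0 | hs0
  · subst h0
    have hz : ∫ ω, |ξ ω| ^ p ∂μ ≤ 0 := by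
      rw [← integral_condExp hm]
      refine integral_nonpos_of_ae ?_
      filter_upwards [hcond] with ω hω
      simpa [Real.zero_rpow hp0.ne'] using hω
    have hz0 : ∫ ω, |ξ ω| ^ p ∂μ = 0 := le_antisymm hz (integral_nonneg fun ω => by positivity)
    rw [integral_eq_zero_iff_of_nonneg (fun ω => by positivity) hξp] at hz0
    have : ∫ ω, a ω * |ξ ω| * u ω ∂μ = 0 := by
      refine integral_eq_zero_of_ae ?_
      filter_upwards [hz0] with ω hω
      have h1 : |ξ ω| = 0 := by
        have h2 : |ξ ω| ^ p = 0 := hω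
        exact (Real.rpow_eq_zero (abs_nonneg _) hp0.ne').1 h2
      simp [h1]
    simp [this]
  · calc ∫ ω, a ω * |ξ ω| * u ω ∂μ
        ≤ ∫ ω, (s * s⁻¹ ^ p / p * (a ω ^ p * |ξ ω| ^ p) + s * u ω ^ 2) ∂μ :=
          integral_mono hInt ((hi.const_mul _).add (hu2.const_mul _)) fun ω =>
            mul_mul_le_young (ha0 ω) (abs_nonneg _) (hu0 ω) (hu1 ω) hs0 hp hp2
      _ = s * s⁻¹ ^ p / p * ∫ ω, a ω ^ p * |ξ ω| ^ p ∂μ + s * ∫ ω, u ω ^ 2 ∂μ := by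
          rw [integral_add (hi.const_mul _) (hu2.const_mul _), integral_const_mul,
            integral_const_mul]
      _ ≤ s * s⁻¹ ^ p / p * ∫ ω, (s * q ^ (2 / p - 1)) ^ p * a ω ^ p ∂μ +
            s * ∫ ω, u ω ^ 2 ∂μ := by gcongr
      _ = ∫ ω, s * s⁻¹ ^ p / p * ((s * q ^ (2 / p - 1)) ^ p * a ω ^ p) ∂μ +
            s * ∫ ω, u ω ^ 2 ∂μ := by rw [← integral_const_mul]
      _ ≤ ∫ ω, (s / 2 * a ω ^ 2 + s * q ^ 2) ∂μ + s * ∫ ω, u ω ^ 2 ∂μ := by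
          gcongr ?_ + _
          refine integral_mono ((hapi.const_mul _).const_mul _)
            ((ha2.const_mul _).add (integrable_const _)) fun ω => ?_
          have := rpow_scale_le (ha0 ω) hs0 hq hp hp2
          dsimp only
          linarith
      _ = _ := by
          rw [integral_add (ha2.const_mul _) (integrable_const _), integral_const_mul]
          simp

/-- One coordinate of one AdaGrad step: the expected descent dominates the proxy energy. -/
lemma integral_proxy_energy_le {Ω : Type*} {m m0 : MeasurableSpace Ω} {μ : Measure Ω}
    [IsProbabilityMeasure μ] (hm : m ≤ m0) {G H V : Ω → ℝ} {lam B s q p : ℝ}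
    (hG : Measurable G) (hGi : Integrable G μ) (hH : Measurable[m] H) (hHB : ∀ ω, |H ω| ≤ B)
    (hV : Measurable[m] V) (hV0 : ∀ ω, 0 ≤ V ω) (hGH : μ[G|m] =ᵐ[μ] H)
    (hl : 0 < lam) (hs : 0 ≤ s) (hq : 0 < q) (hp : 1 < p) (hp2 : p ≤ 2)
    (hξp : Integrable (fun ω => |G ω - H ω| ^ p) μ)
    (hcond : ∀ᵐ ω ∂μ, (μ[fun ω => |G ω - H ω| ^ p|m]) ω ≤ (s * q ^ (2 / p - 1)) ^ p) :
    Integrable (fun ω => H ω ^ 2 / (lam + √(V ω + H ω ^ 2 + s ^ 2))) μ ∧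
    Integrable (fun ω => (|G ω| / (lam + √(V ω + G ω ^ 2))) ^ 2) μ ∧
    Integrable (fun ω => H ω * G ω / (lam + √(V ω + G ω ^ 2))) μ ∧
    1 / 4 * ∫ ω, H ω ^ 2 / (lam + √(V ω + H ω ^ 2 + s ^ 2)) ∂μ ≤
      ∫ ω, H ω * G ω / (lam + √(V ω + G ω ^ 2)) ∂μ +
        2 * s * ∫ ω, (|G ω| / (lam + √(V ω + G ω ^ 2))) ^ 2 ∂μ + s * q ^ 2 := by
  have hbm : Measurable[m] fun ω => lam + √(V ω + H ω ^ 2 + s ^ 2) :=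
    (((hV.add (hH.pow_const 2)).add measurable_const).sqrt).const_add lam
  have hH' : Measurable H := hH.mono hm le_rfl
  have hV' : Measurable V := hV.mono hm le_rfl
  have hbp : ∀ ω, 0 < lam + √(V ω + H ω ^ 2 + s ^ 2) := fun ω => by positivity
  have hcp : ∀ ω, 0 < lam + √(V ω + G ω ^ 2) := fun ω => by positivity
  have hHb : ∀ ω, |H ω| ≤ lam + √(V ω + H ω ^ 2 + s ^ 2) := fun ω =>
    (Real.abs_le_sqrt (by nlinarith [hV0 ω, sq_nonneg s])).trans (le_add_of_nonneg_left hl.le)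
  have hsb : ∀ ω, s ≤ lam + √(V ω + H ω ^ 2 + s ^ 2) := fun ω =>
    (Real.le_sqrt_of_sq_le (by nlinarith [hV0 ω, sq_nonneg (H ω)])).trans
      (le_add_of_nonneg_left hl.le)
  have hGc : ∀ ω, |G ω| ≤ lam + √(V ω + G ω ^ 2) := fun ω =>
    (Real.abs_le_sqrt (by nlinarith [hV0 ω])).trans (le_add_of_nonneg_left hl.le)
  have hcm : Measurable fun ω => lam + √(V ω + G ω ^ 2) :=
    ((hV'.add (hG.pow_const 2)).sqrt).const_add lam
  set b : Ω → ℝ := fun ω => lam + √(V ω + H ω ^ 2 + s ^ 2) with hb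
  set c : Ω → ℝ := fun ω => lam + √(V ω + G ω ^ 2) with hc
  have hHi : Integrable H μ := (integrable_const B).mono' hH'.aestronglyMeasurable
    (.of_forall fun ω => by simpa using hHB ω)
  set a : Ω → ℝ := fun ω => |H ω| / b ω with ha
  set u : Ω → ℝ := fun ω => |G ω| / c ω with hu
  have ham : Measurable[m] a := (measurable_norm.comp hH).div hbm
  have hum : Measurable u := (measurable_norm.comp hG).div hcm
  have ha0 : ∀ ω, 0 ≤ a ω := fun ω => div_nonneg (abs_nonneg _) (hbp ω).le
  have hu0 : ∀ ω, 0 ≤ u ω := fun ω => div_nonneg (abs_nonneg _) (hcp ω).le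
  have ha1 : ∀ ω, a ω ≤ 1 := fun ω => (div_le_one (hbp ω)).2 (hHb ω)
  have hu1 : ∀ ω, u ω ≤ 1 := fun ω => (div_le_one (hcp ω)).2 (hGc ω)
  have hbdd : ∀ w : Ω → ℝ, ∀ R : ℝ, Measurable w → (∀ ω, |w ω| ≤ R) → Integrable w μ :=
    fun w R hw h1 => (integrable_const R).mono' hw.aestronglyMeasurable (.of_forall h1)
  have ha2 : Integrable (fun ω => a ω ^ 2) μ :=
    hbdd _ 1 ((ham.mono hm le_rfl).pow_const 2) fun ω => by
      rw [abs_of_nonneg (sq_nonneg _)]; exact pow_le_one₀ (ha0 ω) (ha1 ω)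
  have hu2 : Integrable (fun ω => u ω ^ 2) μ := hbdd _ 1 (hum.pow_const 2) fun ω => by
      rw [abs_of_nonneg (sq_nonneg _)]; exact pow_le_one₀ (hu0 ω) (hu1 ω)
  have hEi : Integrable (fun ω => H ω ^ 2 / b ω) μ :=
    hbdd _ B ((hH'.pow_const 2).div (hbm.mono hm le_rfl)) fun ω => by
      have e : H ω ^ 2 / b ω = |H ω| * a ω := by
        rw [← sq_abs]
        simp only [ha]
        ring
      rw [abs_of_nonneg (div_nonneg (sq_nonneg _) (hbp ω).le), e]
      calc |H ω| * a ω ≤ |H ω| * 1 := by gcongr; exact ha1 ω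
        _ ≤ B := by simpa using hHB ω
  have hDi : Integrable (fun ω => H ω * G ω / c ω) μ :=
    hbdd _ B ((hH'.mul hG).div hcm) fun ω => by
      have e : |H ω * G ω / c ω| = |H ω| * u ω := by
        rw [abs_div, abs_mul, abs_of_pos (hcp ω), mul_div_assoc]
      rw [e]
      calc |H ω| * u ω ≤ |H ω| * 1 := by gcongr; exact hu1 ω
        _ ≤ B := by simpa using hHB ω
  refine ⟨hEi, hu2, hDi, ?_⟩
  obtain ⟨hPi, hPe⟩ := integral_mul_condExp_eq (φ := fun ω => H ω / b ω) (c := 1) hm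
    (hH.div hbm) (fun ω => by
      rw [abs_div, abs_of_pos (hbp ω)]; exact ha1 ω) hGi
  have hPe' : ∫ ω, H ω / b ω * G ω ∂μ = ∫ ω, H ω ^ 2 / b ω ∂μ := by
    rw [hPe]
    refine integral_congr_ae ?_
    filter_upwards [hGH] with ω hω
    rw [hω]
    ring
  obtain ⟨hNi, hNle⟩ := integral_mul_abs_mul_le (ξ := fun ω => G ω - H ω) hm ham ha0 ha1 hum hu0
    hu1 (hGi.sub hHi) hs hq hp hp2 hξp hcond
  have hpt : ∀ ω, H ω / b ω * G ω ≤
      H ω * G ω / c ω + a ω * |G ω - H ω| * u ω + (s / 4 * a ω ^ 2 + s * u ω ^ 2) := fun ω => by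
    have h1 := abs_step_sub_proxy_le (lam := lam) (v := V ω) (h := H ω) (y := G ω) hl (hV0 ω) hs
    have h2 : s * (a ω * u ω) ≤ s * (1 / 4 * a ω ^ 2 + u ω ^ 2) :=
      mul_le_mul_of_nonneg_left (by nlinarith [sq_nonneg (a ω / 2 - u ω)]) hs
    have h3 : H ω / b ω * G ω = H ω * G ω / b ω := by ring
    have h4 : (|G ω - H ω| + s) * a ω * u ω = a ω * |G ω - H ω| * u ω + s * (a ω * u ω) := by
      ring
    change H ω * G ω / b ω - H ω * G ω / c ω ≤ (|G ω - H ω| + s) * a ω * u ω at h1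
    rw [h3]
    linarith
  have hDN : Integrable (fun ω => H ω * G ω / c ω + a ω * |G ω - H ω| * u ω) μ := hDi.add hNi
  have hau : Integrable (fun ω => s / 4 * a ω ^ 2 + s * u ω ^ 2) μ :=
    (ha2.const_mul (s / 4)).add (hu2.const_mul s)
  have hmono := integral_mono hPi (hDN.add hau) hpt
  have hsplit : ∫ ω, (H ω * G ω / c ω + a ω * |G ω - H ω| * u ω +
      (s / 4 * a ω ^ 2 + s * u ω ^ 2)) ∂μ = ∫ ω, H ω * G ω / c ω ∂μ +
      ∫ ω, a ω * |G ω - H ω| * u ω ∂μ + (s / 4 * ∫ ω, a ω ^ 2 ∂μ + s * ∫ ω, u ω ^ 2 ∂μ) := by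
    rw [integral_add hDN hau, integral_add hDi hNi, integral_add (ha2.const_mul (s / 4)) (hu2.const_mul s),
      integral_const_mul, integral_const_mul]
  have hsa : s * ∫ ω, a ω ^ 2 ∂μ ≤ ∫ ω, H ω ^ 2 / b ω ∂μ := by
    rw [← integral_const_mul]
    refine integral_mono (ha2.const_mul s) hEi fun ω => ?_
    have e : s * a ω ^ 2 = s / b ω * (H ω ^ 2 / b ω) := by
      simp only [ha]
      rw [div_pow, sq_abs, sq (b ω), div_mul_div_comm, mul_div_assoc]
    dsimp only
    rw [e]
    exact mul_le_of_le_one_left (div_nonneg (sq_nonneg _) (hbp ω).le)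
      ((div_le_one (hbp ω)).2 (hsb ω))
  have hmono' := hmono.trans_eq hsplit
  rw [hPe'] at hmono'
  linarith

/-- First moment of the `ℓ²` norm of a noise sequence with bounded `p`-th moments. -/
lemma integral_sqrt_sum_sq_le {Ω : Type*} {m0 : MeasurableSpace Ω} {μ : Measure Ω}
    [IsProbabilityMeasure μ] {ξ : ℕ → Ω → ℝ} {σ p : ℝ} (hσ : 0 ≤ σ) (hp : 1 < p) (hp2 : p ≤ 2)
    (T : ℕ) (hξ : ∀ t ∈ Icc 1 T, Measurable (ξ t))
    (hξp : ∀ t ∈ Icc 1 T, Integrable (fun ω => |ξ t ω| ^ p) μ)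
    (hle : ∀ t ∈ Icc 1 T, ∫ ω, |ξ t ω| ^ p ∂μ ≤ σ ^ p) :
    Integrable (fun ω => √(∑ t ∈ Icc 1 T, ξ t ω ^ 2)) μ ∧
    ∫ ω, √(∑ t ∈ Icc 1 T, ξ t ω ^ 2) ∂μ ≤ σ * (T : ℝ) ^ (1 / p) := by
  have hp0 : 0 < p := by linarith
  have hp1 : 1 / p ≤ 1 := by rw [div_le_one hp0]; exact hp.le
  set Y : Ω → ℝ := fun ω => ∑ t ∈ Icc 1 T, |ξ t ω| ^ p with hY
  have hY0 : ∀ ω, 0 ≤ Y ω := fun ω => sum_nonneg fun _ _ => by positivity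
  have hYi : Integrable Y μ := integrable_finsetSum _ hξp
  have hYp : Integrable (fun ω => Y ω ^ (1 / p)) μ := by
    refine ((integrable_const (1 : ℝ)).add hYi).mono'
      (hYi.aestronglyMeasurable.aemeasurable.pow_const _).aestronglyMeasurable
      (.of_forall fun ω => ?_)
    rw [Real.norm_of_nonneg (Real.rpow_nonneg (hY0 ω) _)]
    change Y ω ^ (1 / p) ≤ 1 + Y ω
    calc Y ω ^ (1 / p) ≤ (1 + Y ω) ^ (1 / p) := by
          exact Real.rpow_le_rpow (hY0 ω) (by linarith) (by positivity)
      _ ≤ (1 + Y ω) ^ (1 : ℝ) :=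
          Real.rpow_le_rpow_of_exponent_le (by linarith [hY0 ω]) hp1
      _ = 1 + Y ω := Real.rpow_one _
  have hpt : ∀ ω, √(∑ t ∈ Icc 1 T, ξ t ω ^ 2) ≤ Y ω ^ (1 / p) := fun ω =>
    sqrt_sum_sq_le_rpow_sum _ _ hp hp2
  have hNm : Measurable fun ω => √(∑ t ∈ Icc 1 T, ξ t ω ^ 2) :=
    (Finset.measurable_sum _ fun t ht => (hξ t ht).pow_const 2).sqrt
  have hNi : Integrable (fun ω => √(∑ t ∈ Icc 1 T, ξ t ω ^ 2)) μ :=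
    hYp.mono' hNm.aestronglyMeasurable (.of_forall fun ω => by
      rw [Real.norm_of_nonneg (Real.sqrt_nonneg _)]; exact hpt ω)
  refine ⟨hNi, ?_⟩
  calc ∫ ω, √(∑ t ∈ Icc 1 T, ξ t ω ^ 2) ∂μ ≤ ∫ ω, Y ω ^ (1 / p) ∂μ :=
        integral_mono hNi hYp hpt
    _ ≤ (∫ ω, Y ω ∂μ) ^ (1 / p) :=
        (Real.concaveOn_rpow (by positivity) hp1).le_map_integral
          (Real.continuous_rpow_const (by positivity)).continuousOn isClosed_Ici
          (.of_forall hY0) hYi hYp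
    _ ≤ (T * σ ^ p) ^ (1 / p) := by
        refine Real.rpow_le_rpow (integral_nonneg hY0) ?_ (by positivity)
        rw [hY, integral_finsetSum _ hξp]
        simpa using sum_le_sum hle
    _ = σ * (T : ℝ) ^ (1 / p) := by
        rw [Real.mul_rpow (by positivity) (by positivity), ← Real.rpow_mul hσ,
          mul_one_div_cancel hp0.ne', Real.rpow_one, mul_comm]

/-- Jensen's inequality for `x ↦ log (1 + x / lam)`. -/
lemma integral_log_one_add_le {Ω : Type*} {m0 : MeasurableSpace Ω} {μ : Measure Ω}
    [IsProbabilityMeasure μ] {X : Ω → ℝ} {lam R : ℝ} (hl : 0 < lam) (hX : Measurable X)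
    (hX0 : ∀ ω, 0 ≤ X ω) (hXi : Integrable X μ) (hR : ∫ ω, X ω ∂μ ≤ R) :
    Integrable (fun ω => Real.log (1 + X ω / lam)) μ ∧
    ∫ ω, Real.log (1 + X ω / lam) ∂μ ≤ Real.log (1 + R / lam) := by
  have hR0 : 0 ≤ R := (integral_nonneg hX0).trans hR
  have hi : Integrable (fun ω => Real.log (1 + X ω / lam)) μ := by
    refine (hXi.div_const lam).mono'
      ((hX.div_const lam).const_add 1).log.aestronglyMeasurable (.of_forall fun ω => ?_)
    have h0 : 0 ≤ X ω / lam := div_nonneg (hX0 ω) hl.le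
    rw [Real.norm_of_nonneg (Real.log_nonneg (by linarith))]
    linarith [Real.log_le_sub_one_of_pos (show 0 < 1 + X ω / lam by linarith)]
  refine ⟨hi, ?_⟩
  have hpt : ∀ ω, Real.log (1 + X ω / lam) ≤ Real.log (1 + R / lam) - R / (lam + R) +
      X ω / (lam + R) := fun ω => by
    have h0 : 0 ≤ X ω := hX0 ω
    have e : 1 + X ω / lam = (1 + R / lam) * ((lam + X ω) / (lam + R)) := by
      have : lam + R ≠ 0 := by positivity
      field_simp
    rw [e, Real.log_mul (by positivity) (by positivity)]
    have h2 := Real.log_le_sub_one_of_pos (show 0 < (lam + X ω) / (lam + R) by positivity)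
    have h3 : (lam + X ω) / (lam + R) - 1 = X ω / (lam + R) - R / (lam + R) := by
      have : lam + R ≠ 0 := by positivity
      field_simp
      ring
    linarith
  calc ∫ ω, Real.log (1 + X ω / lam) ∂μ
      ≤ ∫ ω, (Real.log (1 + R / lam) - R / (lam + R) + X ω / (lam + R)) ∂μ :=
        integral_mono hi ((integrable_const _).add (hXi.div_const _)) hpt
    _ = Real.log (1 + R / lam) - R / (lam + R) + (∫ ω, X ω ∂μ) / (lam + R) := by
        rw [integral_add (integrable_const _) (hXi.div_const _), integral_div]
        simp
    _ ≤ Real.log (1 + R / lam) - R / (lam + R) + R / (lam + R) := by gcongr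
    _ = _ := by ring

/-- The effective offset of the proxy step size is dominated by `lam` and the noise level. -/
lemma offset_le {σ lam Z T p : ℝ} (hσ : 0 ≤ σ) (hl : 0 < lam) (hT : 1 ≤ T) (hp : 1 < p)
    (hp2 : p ≤ 2) (hZ : 0 < Z) (hσZ : σ * T ^ (1 / p) ≤ Z) :
    σ * √(Real.log (1 + Z / lam) / T) ^ (1 - 2 / p) ≤ 2 * lam + σ * T ^ (1 / p) := by
  have hz : 0 < Z / lam := by positivity
  set l := Real.log (1 + Z / lam) with hldef
  have hl0 : 0 < l := Real.log_pos (by linarith)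
  have hT0 : 0 < T := by linarith
  have hp0 : 0 < p := by linarith
  have h1p : 1 / p ≤ 1 := by rw [div_le_one hp0]; exact hp.le
  have h2p : 1 / 2 ≤ 1 / p := one_div_le_one_div_of_le hp0 hp2
  have e : √(l / T) ^ (1 - 2 / p) = l ^ (1 / 2 - 1 / p) * T ^ (1 / p - 1 / 2) := by
    rw [Real.sqrt_eq_rpow, ← Real.rpow_mul (by positivity), Real.div_rpow hl0.le hT0.le,
      show 1 / 2 * (1 - 2 / p) = 1 / 2 - 1 / p by ring,
      show 1 / p - 1 / 2 = -(1 / 2 - 1 / p) by ring, Real.rpow_neg hT0.le]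
    rfl
  have hTle : T ^ (1 / p - 1 / 2) ≤ T ^ (1 / p) :=
    Real.rpow_le_rpow_of_exponent_le hT (by linarith)
  rw [e]
  rcases le_or_gt 1 l with h | h
  · have : l ^ (1 / 2 - 1 / p) ≤ 1 := Real.rpow_le_one_of_one_le_of_nonpos h (by linarith)
    calc σ * (l ^ (1 / 2 - 1 / p) * T ^ (1 / p - 1 / 2)) ≤ σ * (1 * T ^ (1 / p)) := by gcongr
      _ ≤ _ := by rw [one_mul]; linarith
  · have hexp : 1 + Z / lam ≤ 1 + 2 * l := by
      have h1 : Real.exp l = 1 + Z / lam := Real.exp_log (by linarith)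
      have h2 := Real.abs_exp_sub_one_sub_id_le (x := l) (by rw [abs_of_pos hl0]; exact h.le)
      have := (abs_le.1 h2).2
      nlinarith
    have hZl : Z ≤ 2 * l * lam := (div_le_iff₀ hl).1 (by linarith)
    have hll : l ^ (1 / 2 - 1 / p) * l ≤ 1 := by
      nth_rewrite 2 [← Real.rpow_one l]
      rw [← Real.rpow_add hl0]
      exact Real.rpow_le_one hl0.le h.le (by linarith)
    have : 0 ≤ σ * T ^ (1 / p) := by positivity
    calc σ * (l ^ (1 / 2 - 1 / p) * T ^ (1 / p - 1 / 2))
        ≤ σ * (l ^ (1 / 2 - 1 / p) * T ^ (1 / p)) := by gcongr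
      _ = l ^ (1 / 2 - 1 / p) * (σ * T ^ (1 / p)) := by ring
      _ ≤ l ^ (1 / 2 - 1 / p) * (2 * l * lam) :=
          mul_le_mul_of_nonneg_left (hσZ.trans hZl) (by positivity)
      _ = l ^ (1 / 2 - 1 / p) * l * (2 * lam) := by ring
      _ ≤ 1 * (2 * lam) := by gcongr
      _ ≤ _ := by linarith

/-- Converting the energy bound into the final rate. -/
lemma rate_of_energy_bound {y A E D Λ l T p : ℝ} (hA : 0 ≤ A) (hE : 0 ≤ E) (hD : 0 ≤ D)
    (hΛ : 0 ≤ Λ) (hl : 0 ≤ l) (hT : 1 ≤ T) (hp : 1 < p)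
    (hAle : A ≤ 36 * (D + Λ * (T ^ (1 / p - 1 / 2) * l ^ (3 / 2 - 1 / p))))
    (hy : y ≤ 2 * A + 2 * √(A * (3 * E + 2 * (Λ * T ^ (1 / p))))) :
    y / √T ≤ 144 * ((E + D) / √T + Λ * l ^ (1 / (p / (p - 1)) + 1 / 2) / T ^ ((p - 1) / p) +
      √(D * Λ) / T ^ ((p - 1) / (2 * p)) +
      Λ * l ^ (1 / (2 * (p / (p - 1))) + 1 / 4) / T ^ ((3 * p - 4) / (4 * p))) := by
  have hT0 : 0 < T := by linarith
  have hp0 : 0 < p := by linarith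
  have hp1 : p - 1 ≠ 0 := by linarith
  set X := Λ * (T ^ (1 / p - 1 / 2) * l ^ (3 / 2 - 1 / p)) with hX
  have hX0 : 0 ≤ X := by positivity
  set P := Λ * T ^ (1 / p) with hP
  have hP0 : 0 ≤ P := by positivity
  have hsqrt : √(A * (3 * E + 2 * P)) ≤ (A + E) + 9 * (√(D * P) + √(X * P)) := by
    have hDP := Real.sq_sqrt (show 0 ≤ D * P by positivity)
    have hXP := Real.sq_sqrt (show 0 ≤ X * P by positivity)
    have hDP0 := Real.sqrt_nonneg (D * P)
    have hXP0 := Real.sqrt_nonneg (X * P)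
    have h1 : A * P ≤ 36 * (D + X) * P := by gcongr
    refine Real.sqrt_le_iff.2 ⟨by positivity, ?_⟩
    have h2 : 3 * (A * E) ≤ (A + E) ^ 2 := by nlinarith [sq_nonneg (A - E), mul_nonneg hA hE]
    have h3 : 72 * (D * P + X * P) ≤ (9 * (√(D * P) + √(X * P))) ^ 2 := by
      nlinarith [mul_nonneg hDP0 hXP0, mul_nonneg hD hP0, mul_nonneg hX0 hP0]
    nlinarith [mul_nonneg (add_nonneg hA hE) (add_nonneg hDP0 hXP0)]
  have hy' : y ≤ 144 * (E + D + X + √(D * P) + √(X * P)) := by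
    have hDP0 := Real.sqrt_nonneg (D * P)
    have hXP0 := Real.sqrt_nonneg (X * P)
    linarith
  have hsT : √T = T ^ (1 / 2 : ℝ) := Real.sqrt_eq_rpow T
  have hsT0 : 0 < √T := by positivity
  have ediv : ∀ a b : ℝ, T ^ a / √T = (T ^ b)⁻¹ ↔ T ^ (a - 1 / 2) = T ^ (-b) := fun a b => by
    rw [hsT, ← Real.rpow_sub hT0, Real.rpow_neg hT0.le]
  have eX : X / √T = Λ * l ^ (1 / (p / (p - 1)) + 1 / 2) / T ^ ((p - 1) / p) := by
    have h1 : 1 / (p / (p - 1)) + 1 / 2 = 3 / 2 - 1 / p := by field_simp; ring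
    have h2 : T ^ (1 / p - 1 / 2) / √T = (T ^ ((p - 1) / p))⁻¹ := by
      rw [ediv]
      congr 1
      field_simp
      ring
    rw [h1, div_eq_mul_inv (Λ * l ^ (3 / 2 - 1 / p)), ← h2, hX]
    ring
  have eDP : √(D * P) / √T = √(D * Λ) / T ^ ((p - 1) / (2 * p)) := by
    have h1 : √(D * P) = √(D * Λ) * T ^ (1 / (2 * p)) := by
      rw [hP, ← mul_assoc, Real.sqrt_mul (by positivity), Real.sqrt_eq_rpow (T ^ (1 / p)),
        ← Real.rpow_mul hT0.le]
      congr 2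
      field_simp
    have h2 : T ^ (1 / (2 * p)) / √T = (T ^ ((p - 1) / (2 * p)))⁻¹ := by
      rw [ediv]
      congr 1
      field_simp
      ring
    rw [h1, mul_div_assoc, h2, ← div_eq_mul_inv]
  have eXP : √(X * P) / √T =
      Λ * l ^ (1 / (2 * (p / (p - 1))) + 1 / 4) / T ^ ((3 * p - 4) / (4 * p)) := by
    have h1 : 1 / (2 * (p / (p - 1))) + 1 / 4 = (3 / 2 - 1 / p) * (1 / 2) := by
      field_simp; ring
    have h3 : X * P = (Λ * l ^ ((3 / 2 - 1 / p) * (1 / 2)) * T ^ (1 / p - 1 / 4)) ^ 2 := by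
      have e1 : l ^ (3 / 2 - 1 / p) = (l ^ ((3 / 2 - 1 / p) * (1 / 2))) ^ 2 := by
        rw [← Real.rpow_natCast, ← Real.rpow_mul hl]
        congr 1
        push_cast
        ring
      have e2 : T ^ (1 / p - 1 / 2) * T ^ (1 / p) = (T ^ (1 / p - 1 / 4)) ^ 2 := by
        rw [← Real.rpow_natCast, ← Real.rpow_mul hT0.le, ← Real.rpow_add hT0]
        congr 1
        push_cast
        ring
      rw [mul_pow, mul_pow, ← e1, ← e2, hX, hP]
      ring
    have h2 : T ^ (1 / p - 1 / 4) / √T = (T ^ ((3 * p - 4) / (4 * p)))⁻¹ := by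
      rw [ediv]
      congr 1
      field_simp
      ring
    rw [h3, Real.sqrt_sq (by positivity), h1, mul_div_assoc, h2, ← div_eq_mul_inv]
  calc y / √T ≤ 144 * (E + D + X + √(D * P) + √(X * P)) / √T := by gcongr
    _ = 144 * ((E + D) / √T + X / √T + √(D * P) / √T + √(X * P) / √T) := by ring
    _ = _ := by rw [eX, eDP, eXP]

/-- Pathwise bound of the `ℓ¹` norm of a gradient sequence by its proxy energy. -/
lemma sum_abs_le_proxy_energy (G H : ℕ → ℝ) {lam s θ : ℝ} (hl : 0 < lam) (hs : 0 ≤ s)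
    (hθ : 0 < θ) (T : ℕ) :
    ∑ t ∈ Icc 1 T, |H t| ≤ √T *
      ((2 + θ) * ∑ t ∈ Icc 1 T,
          H t ^ 2 / (lam + √(∑ r ∈ Icc 1 (t - 1), G r ^ 2 + H t ^ 2 + s ^ 2)) +
        (lam + s + √(∑ t ∈ Icc 1 T, (G t - H t) ^ 2)) / θ) := by
  set N := √(∑ t ∈ Icc 1 T, (G t - H t) ^ 2)
  have hN : 0 ≤ N := Real.sqrt_nonneg _
  have hS2 : 0 ≤ ∑ t ∈ Icc 1 T, H t ^ 2 := sum_nonneg fun _ _ => sq_nonneg _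
  set S := √(∑ t ∈ Icc 1 T, H t ^ 2)
  have hS : 0 ≤ S := Real.sqrt_nonneg _
  set A := ∑ t ∈ Icc 1 T, H t ^ 2 / (lam + √(∑ r ∈ Icc 1 (t - 1), G r ^ 2 + H t ^ 2 + s ^ 2))
    with hA
  have hV : ∀ t, 0 ≤ ∑ r ∈ Icc 1 (t - 1), G r ^ 2 := fun t => sum_nonneg fun _ _ => sq_nonneg _
  have hA0 : 0 ≤ A := sum_nonneg fun t _ => by have := hV t; positivity
  have hVN : √(∑ t ∈ Icc 1 T, G t ^ 2) ≤ N + S := by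
    simpa using sqrt_sum_add_sq_le (Icc 1 T) (fun t => G t - H t) H
  have hb : ∀ t ∈ Icc 1 T, lam + √(∑ r ∈ Icc 1 (t - 1), G r ^ 2 + H t ^ 2 + s ^ 2) ≤
      (lam + s + N) + 2 * S := by
    intro t ht
    have h1 : √(∑ r ∈ Icc 1 (t - 1), G r ^ 2) ≤ √(∑ t ∈ Icc 1 T, G t ^ 2) :=
      Real.sqrt_le_sqrt (sum_le_sum_of_subset_of_nonneg
        (Icc_subset_Icc_right (by have := (mem_Icc.1 ht).2; omega)) fun _ _ _ => sq_nonneg _)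
    have h2 : |H t| ≤ S := Real.abs_le_sqrt
      (single_le_sum (f := fun t => H t ^ 2) (fun _ _ => sq_nonneg _) ht)
    have h3 : √(∑ r ∈ Icc 1 (t - 1), G r ^ 2 + H t ^ 2 + s ^ 2) ≤
        √(∑ r ∈ Icc 1 (t - 1), G r ^ 2) + |H t| + s := by
      have h4 := Real.sqrt_nonneg (∑ r ∈ Icc 1 (t - 1), G r ^ 2)
      refine Real.sqrt_le_iff.2 ⟨by positivity, ?_⟩
      nlinarith [Real.sq_sqrt (hV t), sq_abs (H t), mul_nonneg h4 (abs_nonneg (H t)),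
        mul_nonneg h4 hs, mul_nonneg (abs_nonneg (H t)) hs]
    linarith
  have hSle : S ^ 2 ≤ A * ((lam + s + N) + 2 * S) := by
    rw [Real.sq_sqrt hS2, hA, sum_mul]
    refine sum_le_sum fun t ht => ?_
    have h0 : 0 < lam + √(∑ r ∈ Icc 1 (t - 1), G r ^ 2 + H t ^ 2 + s ^ 2) := by positivity
    calc H t ^ 2 = H t ^ 2 / (lam + √(∑ r ∈ Icc 1 (t - 1), G r ^ 2 + H t ^ 2 + s ^ 2)) *
          (lam + √(∑ r ∈ Icc 1 (t - 1), G r ^ 2 + H t ^ 2 + s ^ 2)) := by field_simp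
      _ ≤ _ := mul_le_mul_of_nonneg_left (hb t ht) (by positivity)
  have hSb := le_of_sq_le_mul_add hA0 (by positivity) hθ hSle
  have hcs : ∑ t ∈ Icc 1 T, |H t| ≤ √T * S := by
    rw [← Real.sqrt_mul (by positivity)]
    refine Real.le_sqrt_of_sq_le ?_
    have := sq_sum_le_card_mul_sum_sq (s := Icc 1 T) (f := fun t => |H t|)
    simpa using this
  refine hcs.trans (mul_le_mul_of_nonneg_left ?_ (Real.sqrt_nonneg _))
  linarith

lemma natFilt_le {Ω : Type} [m0 : MeasurableSpace Ω] {d : ℕ}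
    {g : ℕ → Ω → EuclideanSpace ℝ (Fin d)} (hg : ∀ t, Measurable (g t)) (t : ℕ) :
    natFilt g t ≤ m0 :=
  iSup₂_le fun s _ => (hg s).comap_le

lemma measurable_natFilt {Ω : Type} [MeasurableSpace Ω] {d : ℕ}
    {g : ℕ → Ω → EuclideanSpace ℝ (Fin d)} {s t : ℕ} (hs : s ∈ Icc 1 t) :
    Measurable[natFilt g t] (g s) :=
  measurable_iff_comap_le.2 (le_iSup₂_of_le s hs le_rfl)

lemma measurable_natFilt_coord {Ω : Type} [MeasurableSpace Ω] {d : ℕ}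
    {g : ℕ → Ω → EuclideanSpace ℝ (Fin d)} {s t : ℕ} (hs : s ∈ Icc 1 t) (i : Fin d) :
    Measurable[natFilt g t] fun ω => g s ω i :=
  (EuclideanSpace.proj (𝕜 := ℝ) i).continuous.measurable.comp (measurable_natFilt hs)

lemma measurable_adaV {Ω : Type} [MeasurableSpace Ω] {d : ℕ}
    (g : ℕ → Ω → EuclideanSpace ℝ (Fin d)) (t : ℕ) (i : Fin d) :
    Measurable[natFilt g t] fun ω => adaV g t ω i :=
  Finset.measurable_sum _ fun _ hs => (measurable_natFilt_coord hs i).pow_const 2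

/-- AdaGrad iterates are predictable. -/
lemma measurable_iterate {Ω : Type} [MeasurableSpace Ω] {d : ℕ}
    {g x : ℕ → Ω → EuclideanSpace ℝ (Fin d)} {x₁ : EuclideanSpace ℝ (Fin d)} {γ lam : ℝ}
    (hx1 : ∀ ω, x 1 ω = x₁)
    (hx : ∀ t, 1 ≤ t → ∀ ω (i : Fin d),
      x (t + 1) ω i = x t ω i - γ * g t ω i / (lam + Real.sqrt (adaV g t ω i)))
    (t : ℕ) : Measurable[natFilt g t] (x (t + 1)) := by
  induction t with
  | zero =>
    have : x (0 + 1) = fun _ => x₁ := funext hx1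
    rw [this]
    exact measurable_const
  | succ t ih =>
    have hmono : natFilt g t ≤ natFilt g (t + 1) :=
      biSup_mono fun s hs => Icc_subset_Icc_right (by omega) hs
    have ih' := ih.mono hmono le_rfl
    have hi : ∀ i, Measurable[natFilt g (t + 1)] fun ω => x (t + 1 + 1) ω i := fun i => by
      have e : (fun ω => x (t + 1 + 1) ω i) = fun ω =>
          x (t + 1) ω i - γ * g (t + 1) ω i / (lam + Real.sqrt (adaV g (t + 1) ω i)) :=
        funext fun ω => hx (t + 1) (by omega) ω i
      rw [e]
      exact ((EuclideanSpace.proj (𝕜 := ℝ) i).continuous.measurable.comp ih').sub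
        (((measurable_natFilt_coord (by simp) i).const_mul γ).div
          ((measurable_adaV g (t + 1) i).sqrt.const_add lam))
    exact (WithLp.measurable_toLp 2 (Fin d → ℝ)).comp
      ((@measurable_pi_iff Ω (Fin d) (fun _ => ℝ) (natFilt g (t + 1)) _
        fun ω i => x (t + 1 + 1) ω i).2 hi)

/-- Each AdaGrad step moves every coordinate by at most the learning rate. -/
lemma abs_iterate_sub_le {Ω : Type} {d : ℕ}
    {g x : ℕ → Ω → EuclideanSpace ℝ (Fin d)} {x₁ : EuclideanSpace ℝ (Fin d)} {γ lam : ℝ}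
    (hγ : 0 < γ) (hl : 0 < lam) (hx1 : ∀ ω, x 1 ω = x₁)
    (hx : ∀ t, 1 ≤ t → ∀ ω (i : Fin d),
      x (t + 1) ω i = x t ω i - γ * g t ω i / (lam + Real.sqrt (adaV g t ω i)))
    (t : ℕ) (ω : Ω) (i : Fin d) : |x (t + 1) ω i - x₁ i| ≤ γ * t := by
  induction t with
  | zero => simp [hx1]
  | succ t ih =>
    have hb : |g (t + 1) ω i| ≤ lam + √(adaV g (t + 1) ω i) := by
      have h1 : |g (t + 1) ω i| ≤ √(adaV g (t + 1) ω i) := Real.abs_le_sqrt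
        (single_le_sum (f := fun s => g s ω i ^ 2) (fun _ _ => sq_nonneg _) (by simp))
      linarith
    have hstep : |γ * g (t + 1) ω i / (lam + √(adaV g (t + 1) ω i))| ≤ γ := by
      have hpos : 0 < lam + √(adaV g (t + 1) ω i) := by positivity
      rw [abs_div, abs_mul, abs_of_pos hγ, abs_of_pos hpos, div_le_iff₀ hpos]
      gcongr
    rw [hx (t + 1) (by omega) ω i]
    calc _ = |(x (t + 1) ω i - x₁ i) - γ * g (t + 1) ω i / (lam + √(adaV g (t + 1) ω i))| := by
          congr 1; ring
      _ ≤ _ := (abs_sub _ _).trans (add_le_add ih hstep)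
      _ = _ := by push_cast; ring

/-- The gradient grows at most linearly along the AdaGrad iterates. -/
lemma abs_grad_iterate_le {Ω : Type} {d : ℕ} {f : EuclideanSpace ℝ (Fin d) → ℝ}
    {gradf : EuclideanSpace ℝ (Fin d) → EuclideanSpace ℝ (Fin d)} {L : Fin d → ℝ}
    {g x : ℕ → Ω → EuclideanSpace ℝ (Fin d)} {x₁ : EuclideanSpace ℝ (Fin d)} {γ lam : ℝ}
    (hγ : 0 < γ) (hl : 0 < lam) (hL : ∀ i, 0 < L i)
    (hsm : ∀ u v : EuclideanSpace ℝ (Fin d),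
      |f u - f v - ∑ i, gradf v i * (u i - v i)| ≤ 1 / 2 * ∑ i, L i * (u i - v i) ^ 2)
    (hx1 : ∀ ω, x 1 ω = x₁)
    (hx : ∀ t, 1 ≤ t → ∀ ω (i : Fin d),
      x (t + 1) ω i = x t ω i - γ * g t ω i / (lam + Real.sqrt (adaV g t ω i)))
    {t T : ℕ} (ht : t ∈ Icc 1 T) (ω : Ω) (i : Fin d) :
    |gradf (x t ω) i| ≤ (⨆ i, |gradf x₁ i|) + 3 * (γ * √((∑ i, L i) * ⨆ i, L i) * T) := by
  obtain ⟨ht1, htT⟩ := mem_Icc.1 ht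
  obtain ⟨t, rfl⟩ := Nat.exists_eq_add_of_le' ht1
  have h1 := abs_grad_sub_le hL hsm x₁ (x (t + 1) ω) i
  have h2 : |gradf x₁ i| ≤ ⨆ i, |gradf x₁ i| :=
    le_ciSup (f := fun i => |gradf x₁ i|) (Set.finite_range _).bddAbove i
  have h3 : L i ≤ ⨆ i, L i := le_ciSup (Set.finite_range _).bddAbove i
  have h0 : 0 ≤ ∑ i, L i := sum_nonneg fun i _ => (hL i).le
  have htT' : (t : ℝ) ≤ T := by exact_mod_cast (by omega : t ≤ T)
  have h4 : ∑ j, L j * (x (t + 1) ω j - x₁ j) ^ 2 ≤ (∑ j, L j) * (γ * T) ^ 2 := by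
    rw [sum_mul]
    refine sum_le_sum fun j _ => mul_le_mul_of_nonneg_left ?_ (hL j).le
    rw [← sq_abs]
    gcongr
    exact (abs_iterate_sub_le hγ hl hx1 hx t ω j).trans (by gcongr)
  have h5 : √(L i) * √(∑ j, L j * (x (t + 1) ω j - x₁ j) ^ 2) ≤
      γ * √((∑ i, L i) * ⨆ i, L i) * T := by
    calc √(L i) * √(∑ j, L j * (x (t + 1) ω j - x₁ j) ^ 2)
        ≤ √(⨆ i, L i) * √((∑ j, L j) * (γ * T) ^ 2) := by gcongr
      _ = γ * √((∑ i, L i) * ⨆ i, L i) * T := by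
        rw [Real.sqrt_mul h0, Real.sqrt_mul h0, Real.sqrt_sq (by positivity)]
        ring
  have h6 := abs_sub_abs_le_abs_sub (gradf (x (t + 1) ω) i) (gradf x₁ i)
  linarith

/-- Coordinate-wise smoothness makes the gradient continuous. -/
lemma continuous_grad_coord {d : ℕ} {f : EuclideanSpace ℝ (Fin d) → ℝ}
    {gradf : EuclideanSpace ℝ (Fin d) → EuclideanSpace ℝ (Fin d)} {L : Fin d → ℝ}
    (hL : ∀ i, 0 < L i)
    (hsm : ∀ u v : EuclideanSpace ℝ (Fin d),
      |f u - f v - ∑ i, gradf v i * (u i - v i)| ≤ 1 / 2 * ∑ i, L i * (u i - v i) ^ 2)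
    (i : Fin d) : Continuous fun y => gradf y i := by
  refine continuous_iff_continuousAt.2 fun y => ?_
  have hc : Continuous fun z : EuclideanSpace ℝ (Fin d) =>
      3 * (√(L i) * √(∑ j, L j * (z j - y j) ^ 2)) := by fun_prop
  have h0 := hc.tendsto y
  simp only [sub_self, ne_eq, OfNat.ofNat_ne_zero, not_false_eq_true, zero_pow, mul_zero,
    sum_const_zero, Real.sqrt_zero] at h0
  exact tendsto_iff_dist_tendsto_zero.2 (squeeze_zero (fun _ => dist_nonneg)
    (fun z => abs_grad_sub_le hL hsm y z i) h0)

/-- Single-coordinate AdaGrad bounds: logarithmic step energy, proxy energy, and gradient norm. -/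
lemma coordinate_bounds {Ω : Type*} {m0 : MeasurableSpace Ω} {μ : Measure Ω}
    [IsProbabilityMeasure μ] {m : ℕ → MeasurableSpace Ω} (hm : ∀ t, m t ≤ m0)
    {G H : ℕ → Ω → ℝ} {lam B σ s q p : ℝ} {T : ℕ}
    (hG : ∀ t, Measurable (G t)) (hGi : ∀ t, Integrable (G t) μ)
    (hH : ∀ t ∈ Icc 1 T, Measurable[m (t - 1)] (H t))
    (hHB : ∀ t ∈ Icc 1 T, ∀ ω, |H t ω| ≤ B)
    (hV : ∀ t, Measurable[m t] fun ω => ∑ r ∈ Icc 1 t, G r ω ^ 2)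
    (hGH : ∀ t ∈ Icc 1 T, μ[G t|m (t - 1)] =ᵐ[μ] H t)
    (hl : 0 < lam) (hB : 0 ≤ B) (hσ : 0 ≤ σ) (hs : 0 ≤ s) (hq : 0 < q)
    (hsq : s * q ^ (2 / p - 1) = σ) (hp : 1 < p) (hp2 : p ≤ 2)
    (hξ : ∀ t ∈ Icc 1 T, Integrable (fun ω => |G t ω - H t ω| ^ p) μ ∧
      ∀ᵐ ω ∂μ, (μ[fun ω => |G t ω - H t ω| ^ p|m (t - 1)]) ω ≤ σ ^ p) :
    (∀ t ∈ Icc 1 T, Integrable (fun ω => |H t ω|) μ ∧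
      Integrable (fun ω => (|G t ω| / (lam + √(∑ r ∈ Icc 1 t, G r ω ^ 2))) ^ 2) μ ∧
      Integrable (fun ω => H t ω * G t ω / (lam + √(∑ r ∈ Icc 1 t, G r ω ^ 2))) μ) ∧
    ∑ t ∈ Icc 1 T, ∫ ω, (|G t ω| / (lam + √(∑ r ∈ Icc 1 t, G r ω ^ 2))) ^ 2 ∂μ ≤
      2 * Real.log (1 + (σ * (T : ℝ) ^ (1 / p) + √T * B) / lam) ∧
    ∃ A : ℝ, 0 ≤ A ∧
      1 / 4 * A ≤ ∑ t ∈ Icc 1 T, ∫ ω, H t ω * G t ω / (lam + √(∑ r ∈ Icc 1 t, G r ω ^ 2)) ∂μ +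
        2 * s * ∑ t ∈ Icc 1 T,
          ∫ ω, (|G t ω| / (lam + √(∑ r ∈ Icc 1 t, G r ω ^ 2))) ^ 2 ∂μ + s * q ^ 2 * T ∧
      ∀ θ : ℝ, 0 < θ → ∫ ω, ∑ t ∈ Icc 1 T, |H t ω| ∂μ ≤
        √T * ((2 + θ) * A + (lam + s + σ * (T : ℝ) ^ (1 / p)) / θ) := by
  have hstep := fun t (ht : t ∈ Icc 1 T) =>
    integral_proxy_energy_le (s := s) (q := q) (hm (t - 1)) (hG t) (hGi t) (hH t ht) (hHB t ht)
      (hV (t - 1)) (fun ω => sum_nonneg fun _ _ => sq_nonneg _) (hGH t ht) hl hs hq hp hp2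
      (hξ t ht).1 (by rw [hsq]; exact (hξ t ht).2)
  have hVs : ∀ t ∈ Icc 1 T, ∀ ω, ∑ r ∈ Icc 1 (t - 1), G r ω ^ 2 + G t ω ^ 2 =
      ∑ r ∈ Icc 1 t, G r ω ^ 2 := fun t ht ω => by
    obtain ⟨k, rfl⟩ := Nat.exists_eq_add_of_le' (mem_Icc.1 ht).1
    rw [sum_Icc_succ_top (by omega)]
    rfl
  have hH' : ∀ t ∈ Icc 1 T, Measurable (H t) := fun t ht => (hH t ht).mono (hm _) le_rfl
  have hHi : ∀ t ∈ Icc 1 T, Integrable (fun ω => |H t ω|) μ := fun t ht =>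
    (integrable_const B).mono' (measurable_norm.comp (hH' t ht)).aestronglyMeasurable
      (.of_forall fun ω => by simpa using hHB t ht ω)
  obtain ⟨hNi, hNle⟩ := integral_sqrt_sum_sq_le (μ := μ) (ξ := fun t ω => G t ω - H t ω) hσ hp hp2 T
    (fun t ht => (hG t).sub (hH' t ht)) (fun t ht => (hξ t ht).1) (fun t ht => by
      rw [← integral_condExp (hm (t - 1))]
      calc _ ≤ ∫ _, σ ^ p ∂μ := integral_mono_ae integrable_condExp (integrable_const _) (hξ t ht).2
        _ = σ ^ p := by simp)
  have hui : ∀ t ∈ Icc 1 T,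
      Integrable (fun ω => (|G t ω| / (lam + √(∑ r ∈ Icc 1 t, G r ω ^ 2))) ^ 2) μ :=
    fun t ht => by simpa only [hVs t ht] using (hstep t ht).2.1
  refine ⟨fun t ht => ⟨hHi t ht, hui t ht, by simpa only [hVs t ht] using (hstep t ht).2.2.1⟩, ?_,
    ∑ t ∈ Icc 1 T, ∫ ω, H t ω ^ 2 /
      (lam + √(∑ r ∈ Icc 1 (t - 1), G r ω ^ 2 + H t ω ^ 2 + s ^ 2)) ∂μ, ?_, ?_, ?_⟩
  · set X : Ω → ℝ := fun ω => √(∑ t ∈ Icc 1 T, G t ω ^ 2) with hX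
    have hXm : Measurable X := (Finset.measurable_sum _ fun t _ => (hG t).pow_const 2).sqrt
    have hXle : ∀ ω, X ω ≤ √(∑ t ∈ Icc 1 T, (G t ω - H t ω) ^ 2) + √T * B := fun ω => by
      have h1 := sqrt_sum_add_sq_le (Icc 1 T) (fun t => G t ω - H t ω) (fun t => H t ω)
      simp only [sub_add_cancel] at h1
      refine h1.trans (add_le_add_right ?_ _)
      have h2 : ∑ t ∈ Icc 1 T, H t ω ^ 2 ≤ T * B ^ 2 := by
        calc _ ≤ ∑ t ∈ Icc 1 T, B ^ 2 := sum_le_sum fun t ht => sq_le_sq'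
                (by linarith [(abs_le.1 (hHB t ht ω)).1]) (abs_le.1 (hHB t ht ω)).2
          _ = _ := by simp
      calc _ ≤ √(T * B ^ 2) := Real.sqrt_le_sqrt h2
        _ = √T * B := by rw [Real.sqrt_mul (by positivity), Real.sqrt_sq hB]
    have hbound : Integrable (fun ω => √(∑ t ∈ Icc 1 T, (G t ω - H t ω) ^ 2) + √T * B) μ :=
      hNi.add (integrable_const _)
    have hXi : Integrable X μ := hbound.mono' hXm.aestronglyMeasurable
      (.of_forall fun ω => by rw [Real.norm_of_nonneg (Real.sqrt_nonneg _)]; exact hXle ω)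
    have hXR : ∫ ω, X ω ∂μ ≤ σ * (T : ℝ) ^ (1 / p) + √T * B := by
      refine (integral_mono hXi hbound hXle).trans ?_
      rw [integral_add hNi (integrable_const _)]
      simpa using hNle
    obtain ⟨hlogi, hlog⟩ := integral_log_one_add_le hl hXm (fun ω => Real.sqrt_nonneg _) hXi hXR
    rw [← integral_finsetSum _ hui]
    calc _ ≤ ∫ ω, 2 * Real.log (1 + X ω / lam) ∂μ :=
          integral_mono (integrable_finsetSum _ hui) (hlogi.const_mul 2)
            fun ω => sum_sq_div_sq_le_log (fun t => G t ω) hl T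
      _ ≤ _ := by rw [integral_const_mul]; gcongr
  · exact sum_nonneg fun t _ => integral_nonneg fun ω => by positivity
  · rw [mul_sum, mul_sum, ← sum_add_distrib]
    calc _ ≤ ∑ t ∈ Icc 1 T, (∫ ω, H t ω * G t ω / (lam + √(∑ r ∈ Icc 1 t, G r ω ^ 2)) ∂μ +
          2 * s * ∫ ω, (|G t ω| / (lam + √(∑ r ∈ Icc 1 t, G r ω ^ 2))) ^ 2 ∂μ + s * q ^ 2) :=
          sum_le_sum fun t ht => by simpa only [hVs t ht] using (hstep t ht).2.2.2
      _ = _ := by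
          rw [sum_add_distrib (g := fun _ => s * q ^ 2)]
          simp
          ring
  · intro θ hθ
    have hEi := fun t (ht : t ∈ Icc 1 T) => (hstep t ht).1
    have hi1 := (integrable_finsetSum _ hEi).const_mul (2 + θ)
    have hi2 := (((integrable_const (lam + s)).add hNi).div_const θ)
    have hmono := integral_mono (integrable_finsetSum _ hHi) ((hi1.add hi2).const_mul √T)
      fun ω => sum_abs_le_proxy_energy (fun t => G t ω) (fun t => H t ω) hl hs hθ T
    refine hmono.trans ?_
    rw [integral_const_mul, integral_add' hi1 hi2, integral_const_mul, integral_finsetSum _ hEi,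
      integral_div]
    simp only [Pi.add_apply]
    rw [integral_add (integrable_const _) hNi]
    simp only [integral_const, probReal_univ, one_smul]
    gcongr

/-- Pathwise descent along the AdaGrad iterates. -/
lemma sum_step_le_gap {Ω : Type} {d : ℕ} {f : EuclideanSpace ℝ (Fin d) → ℝ}
    {gradf : EuclideanSpace ℝ (Fin d) → EuclideanSpace ℝ (Fin d)} {L : Fin d → ℝ}
    {g x : ℕ → Ω → EuclideanSpace ℝ (Fin d)} {x₁ : EuclideanSpace ℝ (Fin d)} {γ lam : ℝ}
    (hbdd : BddBelow (Set.range f))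
    (hsm : ∀ u v : EuclideanSpace ℝ (Fin d),
      |f u - f v - ∑ i, gradf v i * (u i - v i)| ≤ 1 / 2 * ∑ i, L i * (u i - v i) ^ 2)
    (hx1 : ∀ ω, x 1 ω = x₁)
    (hx : ∀ t, 1 ≤ t → ∀ ω (i : Fin d),
      x (t + 1) ω i = x t ω i - γ * g t ω i / (lam + Real.sqrt (adaV g t ω i)))
    (T : ℕ) (ω : Ω) :
    γ * ∑ i, ∑ t ∈ Icc 1 T, gradf (x t ω) i * g t ω i / (lam + √(adaV g t ω i)) ≤
      f x₁ - (⨅ y, f y) + γ ^ 2 / 2 * ∑ i, L i * ∑ t ∈ Icc 1 T,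
        (|g t ω i| / (lam + √(adaV g t ω i))) ^ 2 := by
  have key : ∀ T : ℕ,
      γ * ∑ t ∈ Icc 1 T, ∑ i, gradf (x t ω) i * g t ω i / (lam + √(adaV g t ω i)) ≤
        f x₁ - f (x (T + 1) ω) + γ ^ 2 / 2 * ∑ t ∈ Icc 1 T, ∑ i, L i *
          (|g t ω i| / (lam + √(adaV g t ω i))) ^ 2 := by
    intro T
    induction T with
    | zero => simp [hx1]
    | succ T ih =>
      rw [sum_Icc_succ_top (by omega), sum_Icc_succ_top (by omega)]
      have h1 := (abs_le.1 (hsm (x (T + 1 + 1) ω) (x (T + 1) ω))).2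
      have hd : ∀ i, x (T + 1 + 1) ω i - x (T + 1) ω i =
          -γ * (g (T + 1) ω i / (lam + √(adaV g (T + 1) ω i))) := fun i => by
        rw [hx (T + 1) (by omega) ω i]
        ring
      have e1 : ∑ i, gradf (x (T + 1) ω) i * (x (T + 1 + 1) ω i - x (T + 1) ω i) =
          -(γ * ∑ i, gradf (x (T + 1) ω) i * g (T + 1) ω i /
            (lam + √(adaV g (T + 1) ω i))) := by
        rw [mul_sum, ← sum_neg_distrib]
        exact sum_congr rfl fun i _ => by rw [hd]; ring
      have e2 : 1 / 2 * ∑ i, L i * (x (T + 1 + 1) ω i - x (T + 1) ω i) ^ 2 =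
          γ ^ 2 / 2 * ∑ i, L i * (|g (T + 1) ω i| / (lam + √(adaV g (T + 1) ω i))) ^ 2 := by
        rw [mul_sum, mul_sum]
        exact sum_congr rfl fun i _ => by
          rw [hd, div_pow |g (T + 1) ω i|, sq_abs, ← div_pow]; ring
      rw [e1, e2] at h1
      linarith
  have h := key T
  have hinf : ⨅ y, f y ≤ f (x (T + 1) ω) := ciInf_le hbdd _
  rw [sum_comm, sum_comm (s := Icc 1 T)] at h
  simp only [← mul_sum] at h
  linarith

/-- the convergence rate of AdaGrad under heavy-tailed noise.
There is an absolute constant `C > 0` such that, under assumptions (A1)–(A4),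
for every `T ≥ 1` the AdaGrad iterates satisfy
`E[(1/T)∑_{t=1}^T ‖∇f(x_t)‖₁]
  ≤ C·[(dλ + Δ/γ + γ‖L‖₁ ln K_T)/√T + ‖σ‖₁ (ln K_T)^{1/p̄+1/2}/T^{(p−1)/p}
      + √((Δ/γ + γ‖L‖₁ ln K_T)‖σ‖₁)/T^{(p−1)/(2p)}
      + ‖σ‖₁ (ln K_T)^{1/(2p̄)+1/4}/T^{(3p−4)/(4p)}]`,
where `Δ = f(x₁) − f_*`, `p̄ = p/(p−1)` and
`K_T = 1 + (√2‖σ‖_∞ T^{1/p} + 2‖∇f(x₁)‖_∞ T^{1/2} + 2γ√(‖L‖₁‖L‖_∞) T^{3/2})/λ`. -/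
theorem adagrad_heavy_tailed_upper_bound :
    ∃ C : ℝ, 0 < C ∧
    ∀ (d : ℕ) (Ω : Type) [MeasurableSpace Ω] (μ : Measure Ω) [IsProbabilityMeasure μ]
      (f : EuclideanSpace ℝ (Fin d) → ℝ)
      (gradf : EuclideanSpace ℝ (Fin d) → EuclideanSpace ℝ (Fin d))
      (g x : ℕ → Ω → EuclideanSpace ℝ (Fin d)) (x₁ : EuclideanSpace ℝ (Fin d))
      (γ lam p : ℝ) (L σ : Fin d → ℝ),
      0 < γ → 0 < lam →
      (∀ y, HasGradientAt f (gradf y) y) →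
      -- (A1) lower boundedness
      BddBelow (Set.range f) →
      -- (A2) coordinate-wise smoothness
      (∀ i, 0 < L i) →
      (∀ u v : EuclideanSpace ℝ (Fin d),
        |f u - f v - ∑ i, gradf v i * (u i - v i)| ≤ 1 / 2 * ∑ i, L i * (u i - v i) ^ 2) →
      (∀ t, Measurable (g t)) →
      (∀ t, Integrable (g t) μ) →
      -- AdaGrad dynamics
      (∀ ω, x 1 ω = x₁) →
      (∀ t, 1 ≤ t → ∀ ω (i : Fin d),
        x (t + 1) ω i = x t ω i - γ * g t ω i / (lam + Real.sqrt (adaV g t ω i))) →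
      -- (A3) unbiasedness
      (∀ t, 1 ≤ t → ∀ i : Fin d,
        μ[(fun ω => g t ω i) | natFilt g (t - 1)] =ᵐ[μ] fun ω => gradf (x t ω) i) →
      -- (A4) heavy-tailed noise
      1 < p → p ≤ 2 → (∀ i, 0 ≤ σ i) →
      (∀ t, 1 ≤ t → ∀ i : Fin d,
        Integrable (fun ω => |g t ω i - gradf (x t ω) i| ^ p) μ ∧
        ∀ᵐ ω ∂μ,
          (μ[(fun ω' => |g t ω' i - gradf (x t ω') i| ^ p) | natFilt g (t - 1)]) ω ≤ σ i ^ p) →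
      ∀ T : ℕ, 1 ≤ T →
      (∫ ω, (1 / (T : ℝ)) * ∑ t ∈ Finset.Icc 1 T, ∑ i, |gradf (x t ω) i| ∂μ) ≤
        C * (((d : ℝ) * lam + (f x₁ - ⨅ y, f y) / γ +
                γ * (∑ i, L i) * Real.log (1 + (Real.sqrt 2 * (⨆ i, |σ i|) * (T : ℝ) ^ (1 / p) +
                  2 * (⨆ i, |gradf x₁ i|) * (T : ℝ) ^ ((1 : ℝ) / 2) +
                  2 * γ * Real.sqrt ((∑ i, L i) * (⨆ i, L i)) * (T : ℝ) ^ ((3 : ℝ) / 2)) / lam)) /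
                Real.sqrt (T : ℝ) +
              (∑ i, σ i) *
                (Real.log (1 + (Real.sqrt 2 * (⨆ i, |σ i|) * (T : ℝ) ^ (1 / p) +
                  2 * (⨆ i, |gradf x₁ i|) * (T : ℝ) ^ ((1 : ℝ) / 2) +
                  2 * γ * Real.sqrt ((∑ i, L i) * (⨆ i, L i)) * (T : ℝ) ^ ((3 : ℝ) / 2)) / lam)) ^
                  (1 / (p / (p - 1)) + 1 / 2) / (T : ℝ) ^ ((p - 1) / p) +
              Real.sqrt (((f x₁ - ⨅ y, f y) / γ +
                γ * (∑ i, L i) * Real.log (1 + (Real.sqrt 2 * (⨆ i, |σ i|) * (T : ℝ) ^ (1 / p) +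
                  2 * (⨆ i, |gradf x₁ i|) * (T : ℝ) ^ ((1 : ℝ) / 2) +
                  2 * γ * Real.sqrt ((∑ i, L i) * (⨆ i, L i)) * (T : ℝ) ^ ((3 : ℝ) / 2)) / lam)) *
                (∑ i, σ i)) / (T : ℝ) ^ ((p - 1) / (2 * p)) +
              (∑ i, σ i) *
                (Real.log (1 + (Real.sqrt 2 * (⨆ i, |σ i|) * (T : ℝ) ^ (1 / p) +
                  2 * (⨆ i, |gradf x₁ i|) * (T : ℝ) ^ ((1 : ℝ) / 2) +
                  2 * γ * Real.sqrt ((∑ i, L i) * (⨆ i, L i)) * (T : ℝ) ^ ((3 : ℝ) / 2)) / lam)) ^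
                  (1 / (2 * (p / (p - 1))) + 1 / 4) / (T : ℝ) ^ ((3 * p - 4) / (4 * p))) := by
  refine ⟨144, by norm_num, ?_⟩
  intro d Ω _ μ _ f gradf g x x₁ γ lam p L σ hγ hlam _ hbdd hL hsm hg hgi hx1 hx hunb hp hp2 hσ
    hnoise T hT
  set Z : ℝ := Real.sqrt 2 * (⨆ i, |σ i|) * (T : ℝ) ^ (1 / p) +
    2 * (⨆ i, |gradf x₁ i|) * (T : ℝ) ^ ((1 : ℝ) / 2) +
    2 * γ * Real.sqrt ((∑ i, L i) * (⨆ i, L i)) * (T : ℝ) ^ ((3 : ℝ) / 2) with hZ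
  set l : ℝ := Real.log (1 + Z / lam) with hl
  have hT1 : (1 : ℝ) ≤ T := by exact_mod_cast hT
  have hT0 : (0 : ℝ) < T := by linarith
  have hp0 : 0 < p := by linarith
  have hsup1 : 0 ≤ ⨆ i, |σ i| := Real.iSup_nonneg fun i => abs_nonneg _
  have hsup2 : 0 ≤ ⨆ i, |gradf x₁ i| := Real.iSup_nonneg fun i => abs_nonneg _
  have hsup3 : 0 ≤ ⨆ i, L i := Real.iSup_nonneg fun i => (hL i).le
  have hLs : 0 ≤ ∑ i, L i := sum_nonneg fun i _ => (hL i).le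
  have hΛ : 0 ≤ ∑ i, σ i := sum_nonneg fun i _ => hσ i
  have hZ0 : 0 ≤ Z := by positivity
  have hl0 : 0 ≤ l := Real.log_nonneg (by have : 0 ≤ Z / lam := by positivity
                                          linarith)
  have hgap : 0 ≤ f x₁ - ⨅ y, f y := sub_nonneg.2 (ciInf_le hbdd _)
  have hZpos : ∀ _ : Fin d, 0 < Z := fun i => by
    have h1 : 0 < ∑ i, L i := sum_pos (fun i _ => hL i) ⟨i, mem_univ _⟩
    have h2 : 0 < ⨆ i, L i := (hL i).trans_le (le_ciSup (Set.finite_range _).bddAbove i)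
    positivity
  have hlpos : ∀ _ : Fin d, 0 < l := fun i => Real.log_pos (by
    have : 0 < Z / lam := div_pos (hZpos i) hlam
    linarith)
  have hσZ : ∀ i, σ i * (T : ℝ) ^ (1 / p) ≤ Z := fun i => by
    have h1 : σ i ≤ ⨆ i, |σ i| :=
      (le_abs_self _).trans (le_ciSup (f := fun i => |σ i|) (Set.finite_range _).bddAbove i)
    have h2 : 1 ≤ Real.sqrt 2 := Real.one_le_sqrt.2 (by norm_num)
    calc σ i * (T : ℝ) ^ (1 / p) ≤ Real.sqrt 2 * (⨆ i, |σ i|) * (T : ℝ) ^ (1 / p) := by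
          gcongr
          nlinarith
      _ ≤ Z := by rw [hZ, add_assoc]; exact le_add_of_nonneg_right (by positivity)
  set B : ℝ := (⨆ i, |gradf x₁ i|) + 3 * (γ * √((∑ i, L i) * ⨆ i, L i) * T) with hB
  have hB0 : 0 ≤ B := by positivity
  set q : ℝ := √(l / T) with hq
  set s : Fin d → ℝ := fun i => σ i * q ^ (1 - 2 / p) with hs
  have hq0 : ∀ _ : Fin d, 0 < q := fun i => Real.sqrt_pos.2 (div_pos (hlpos i) hT0)
  have hs0 : ∀ i, 0 ≤ s i := fun i => mul_nonneg (hσ i) (Real.rpow_nonneg (hq0 i).le _)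
  have hgc : ∀ t (i : Fin d), Measurable fun ω => g t ω i := fun t i =>
    (EuclideanSpace.proj (𝕜 := ℝ) i).continuous.measurable.comp (hg t)
  have hcoord := fun i : Fin d => coordinate_bounds (μ := μ) (m := natFilt g) (natFilt_le hg)
    (G := fun t ω => g t ω i) (H := fun t ω => gradf (x t ω) i) (lam := lam) (B := B)
    (σ := σ i) (s := s i) (q := q) (p := p) (T := T) (fun t => hgc t i)
    (fun t => (EuclideanSpace.proj (𝕜 := ℝ) i).integrable_comp (hgi t))
    (fun t ht => by
      obtain ⟨k, rfl⟩ := Nat.exists_eq_add_of_le' (mem_Icc.1 ht).1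
      exact (continuous_grad_coord hL hsm i).measurable.comp (measurable_iterate hx1 hx k))
    (fun t ht ω => abs_grad_iterate_le hγ hlam hL hsm hx1 hx ht ω i)
    (fun t => measurable_adaV g t i) (fun t ht => hunb t (mem_Icc.1 ht).1 i) hlam hB0 (hσ i)
    (hs0 i) (hq0 i) (by
      simp only [hs]
      rw [mul_assoc, ← Real.rpow_add (hq0 i), show 1 - 2 / p + (2 / p - 1) = 0 by ring,
        Real.rpow_zero, mul_one]) hp hp2
    (fun t ht => hnoise t (mem_Icc.1 ht).1 i)
  choose hInt hM A hA0 hA hH using hcoord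
  set M : Fin d → ℝ := fun i => ∑ t ∈ Icc 1 T,
    ∫ ω, (|g t ω i| / (lam + √(adaV g t ω i))) ^ 2 ∂μ with hMdef
  set P : Fin d → ℝ := fun i => ∑ t ∈ Icc 1 T,
    ∫ ω, gradf (x t ω) i * g t ω i / (lam + √(adaV g t ω i)) ∂μ with hPdef
  have hA' : ∀ i, 1 / 4 * A i ≤ P i + 2 * s i * M i + s i * q ^ 2 * T := hA
  have hMl : ∀ i, M i ≤ 4 * l := fun i => by
    have hR : σ i * (T : ℝ) ^ (1 / p) + √T * B ≤ 2 * Z := by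
      have h1 : σ i ≤ ⨆ i, |σ i| :=
        (le_abs_self _).trans (le_ciSup (f := fun i => |σ i|) (Set.finite_range _).bddAbove i)
      have h2 : 1 ≤ Real.sqrt 2 := Real.one_le_sqrt.2 (by norm_num)
      have h3 : (T : ℝ) ^ ((3 : ℝ) / 2) = √T * T := by
        rw [Real.sqrt_eq_rpow, show (3 : ℝ) / 2 = 1 / 2 + 1 by norm_num, Real.rpow_add hT0,
          Real.rpow_one]
      have h4 : σ i * (T : ℝ) ^ (1 / p) ≤ Real.sqrt 2 * (⨆ i, |σ i|) * (T : ℝ) ^ (1 / p) := by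
        gcongr
        nlinarith
      have h5 : 0 ≤ (⨆ i, |gradf x₁ i|) * √T := by positivity
      have h6 : 0 ≤ γ * √((∑ i, L i) * ⨆ i, L i) * (√T * T) := by positivity
      have h7 : 0 ≤ σ i * (T : ℝ) ^ (1 / p) := mul_nonneg (hσ i) (by positivity)
      rw [hZ, hB, h3, ← Real.sqrt_eq_rpow]
      linarith
    have h1 : M i ≤ 2 * Real.log (1 + (σ i * (T : ℝ) ^ (1 / p) + √T * B) / lam) := hM i
    have h2 : Real.log (1 + (σ i * (T : ℝ) ^ (1 / p) + √T * B) / lam) ≤ 2 * l := by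
      have h7 : 0 ≤ σ i * (T : ℝ) ^ (1 / p) := mul_nonneg (hσ i) (by positivity)
      have h8 : 0 ≤ Z / lam := by positivity
      rw [hl, ← Nat.cast_ofNat (n := 2), ← Real.log_pow]
      refine Real.log_le_log (by positivity) ?_
      calc 1 + (σ i * (T : ℝ) ^ (1 / p) + √T * B) / lam ≤ 1 + (2 * Z) / lam := by gcongr
        _ ≤ (1 + Z / lam) ^ 2 := by
          rw [mul_div_assoc]
          nlinarith
    linarith
  have hdesc : γ * ∑ i, P i ≤ f x₁ - (⨅ y, f y) + γ ^ 2 / 2 * ∑ i, L i * M i := by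
    have hi1 : ∀ i ∈ univ, Integrable (fun ω => ∑ t ∈ Icc 1 T,
        gradf (x t ω) i * g t ω i / (lam + √(adaV g t ω i))) μ :=
      fun i _ => integrable_finsetSum _ fun t ht => (hInt i t ht).2.2
    have hi2 : ∀ i ∈ univ, Integrable (fun ω => L i * ∑ t ∈ Icc 1 T,
        (|g t ω i| / (lam + √(adaV g t ω i))) ^ 2) μ :=
      fun i _ => (integrable_finsetSum _ fun t ht => (hInt i t ht).2.1).const_mul _
    have hi3 := (integrable_finsetSum _ hi2).const_mul (γ ^ 2 / 2)
    have hmono := integral_mono ((integrable_finsetSum _ hi1).const_mul γ)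
      ((integrable_const (f x₁ - ⨅ y, f y)).add hi3)
      fun ω => sum_step_le_gap hbdd hsm hx1 hx T ω
    rw [integral_const_mul, integral_finsetSum _ hi1, integral_add' (integrable_const _) hi3,
      integral_const_mul, integral_finsetSum _ hi2] at hmono
    simp only [integral_const_mul, integral_const, probReal_univ, one_smul] at hmono
    have e1 : ∀ i, ∫ ω, ∑ t ∈ Icc 1 T,
        gradf (x t ω) i * g t ω i / (lam + √(adaV g t ω i)) ∂μ = P i := fun i =>
      integral_finsetSum _ fun t ht => (hInt i t ht).2.2
    have e2 : ∀ i, ∫ ω, ∑ t ∈ Icc 1 T,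
        (|g t ω i| / (lam + √(adaV g t ω i))) ^ 2 ∂μ = M i := fun i =>
      integral_finsetSum _ fun t ht => (hInt i t ht).2.1
    simpa only [e1, e2] using hmono
  have hsl : ∀ i, s i * l = σ i * ((T : ℝ) ^ (1 / p - 1 / 2) * l ^ (3 / 2 - 1 / p)) := fun i => by
    have h1 : q ^ (1 - 2 / p) = l ^ (1 / 2 - 1 / p) * (T : ℝ) ^ (1 / p - 1 / 2) := by
      rw [hq, Real.sqrt_eq_rpow, ← Real.rpow_mul (by positivity), Real.div_rpow hl0 hT0.le,
        show 1 / 2 * (1 - 2 / p) = 1 / 2 - 1 / p by ring,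
        show 1 / p - 1 / 2 = -(1 / 2 - 1 / p) by ring, Real.rpow_neg hT0.le, div_eq_mul_inv]
    have h2 : l ^ (3 / 2 - 1 / p) = l ^ (1 / 2 - 1 / p) * l := by
      nth_rewrite 3 [← Real.rpow_one l]
      rw [← Real.rpow_add (hlpos i)]
      congr 1
      ring
    simp only [hs]
    rw [h1, h2]
    ring
  have hqT : q ^ 2 * T = l := by
    rw [hq, Real.sq_sqrt (by positivity)]
    field_simp
  have hAle : ∑ i, A i ≤ 36 * (((f x₁ - ⨅ y, f y) / γ + γ * (∑ i, L i) * l) +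
      (∑ i, σ i) * ((T : ℝ) ^ (1 / p - 1 / 2) * l ^ (3 / 2 - 1 / p))) := by
    have h1 : ∑ i, 1 / 4 * A i ≤ ∑ i, (P i + 9 * (s i * l)) := sum_le_sum fun i _ => by
      have h2 := mul_le_mul_of_nonneg_left (hMl i) (hs0 i)
      have h3 : s i * q ^ 2 * T = s i * l := by rw [← hqT]; ring
      linarith [hA' i]
    rw [sum_add_distrib, ← mul_sum, ← mul_sum] at h1
    simp only [hsl] at h1
    rw [← sum_mul] at h1
    have h4 : ∑ i, L i * M i ≤ (∑ i, L i) * (4 * l) := by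
      rw [sum_mul]
      exact sum_le_sum fun i _ => mul_le_mul_of_nonneg_left (hMl i) (hL i).le
    have h5 : ∑ i, P i ≤ (f x₁ - ⨅ y, f y) / γ + 2 * (γ * (∑ i, L i) * l) := by
      have h6 : γ * ∑ i, P i ≤ γ * ((f x₁ - ⨅ y, f y) / γ + 2 * (γ * (∑ i, L i) * l)) := by
        have h7 : γ * ((f x₁ - ⨅ y, f y) / γ + 2 * (γ * (∑ i, L i) * l)) =
            f x₁ - (⨅ y, f y) + γ ^ 2 / 2 * ((∑ i, L i) * (4 * l)) := by
          field_simp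
          ring
        rw [h7]
        exact hdesc.trans (by gcongr)
      exact le_of_mul_le_mul_left h6 hγ
    have h8 : 0 ≤ (f x₁ - ⨅ y, f y) / γ := by positivity
    have h9 : 0 ≤ γ * (∑ i, L i) * l := by positivity
    linarith
  have hA0s : 0 ≤ ∑ i, A i := sum_nonneg fun i _ => hA0 i
  have hW : ∀ i, lam + s i + σ i * (T : ℝ) ^ (1 / p) ≤
      3 * lam + 2 * (σ i * (T : ℝ) ^ (1 / p)) := fun i => by
    have : s i ≤ 2 * lam + σ i * (T : ℝ) ^ (1 / p) :=
      offset_le (hσ i) hlam hT1 hp hp2 (hZpos i) (hσZ i)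
    linarith
  set Y : ℝ := ∑ i, ∫ ω, ∑ t ∈ Icc 1 T, |gradf (x t ω) i| ∂μ with hY
  have hYle : Y / √T ≤ 2 * ∑ i, A i +
      2 * √((∑ i, A i) * (3 * (d * lam) + 2 * ((∑ i, σ i) * (T : ℝ) ^ (1 / p)))) := by
    have := le_two_mul_sqrt_of_forall (y := Y / √T - 2 * ∑ i, A i) hA0s
      (b := 3 * (d * lam) + 2 * ((∑ i, σ i) * (T : ℝ) ^ (1 / p))) (by positivity) fun θ hθ => by
        have h1 : Y ≤ ∑ i, √T * ((2 + θ) * A i +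
            (3 * lam + 2 * (σ i * (T : ℝ) ^ (1 / p))) / θ) := by
          refine sum_le_sum fun i _ => (hH i θ hθ).trans ?_
          gcongr √T * (_ + ?_ / θ)
          exact hW i
        have h2 : ∑ i, √T * ((2 + θ) * A i + (3 * lam + 2 * (σ i * (T : ℝ) ^ (1 / p))) / θ) =
            √T * ((2 + θ) * ∑ i, A i +
              (3 * (d * lam) + 2 * ((∑ i, σ i) * (T : ℝ) ^ (1 / p))) / θ) := by
          rw [← mul_sum, sum_add_distrib, ← mul_sum, ← sum_div, sum_add_distrib, ← mul_sum,
            ← mul_sum, ← sum_mul]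
          simp
        rw [h2, mul_comm, ← div_le_iff₀ (by positivity)] at h1
        linarith
    linarith
  have hfin := rate_of_energy_bound (E := d * lam) hA0s (by positivity) (by positivity) hΛ hl0 hT1
    hp hAle hYle
  have hLHS : ∫ ω, (1 / (T : ℝ)) * ∑ t ∈ Icc 1 T, ∑ i, |gradf (x t ω) i| ∂μ = Y / √T / √T := by
    have hi : ∀ i ∈ univ, Integrable (fun ω => ∑ t ∈ Icc 1 T, |gradf (x t ω) i|) μ :=
      fun i _ => integrable_finsetSum _ fun t ht => (hInt i t ht).1
    rw [integral_const_mul, div_div, Real.mul_self_sqrt hT0.le, hY, ← integral_finsetSum _ hi]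
    simp only [sum_comm (s := Icc 1 T)]
    ring
  rw [hLHS, add_assoc ((d : ℝ) * lam)]
  exact hfin
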